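/- Kernel form of the archimedean transform: Fix η > 40, H ∈ C_η, and α = (α₁, α₂, α₃) ∈ ℂ³ with Re α_i = 0 and α₁ + α₂ + α₃ = 0. Let (s₀, s) ∈ ℂ² satisfy Re s₀ > 1/100, Re s < 4, 2·Re s − Re s₀ − 1/100 > 0, Re s₀ + 2·Re s − 1 − 1/100 > 0, and 1 + 1/100 − Re s₀ − Re s > 0, and let σ₁ be any real number with Re s₀ + 2·Re s − 1 − 1/100 < σ₁ < Re s. Then (F_α H)(s₀, s) = (π^{1/2−s}/4) · (1/(2π)) ∫_ℝ (H(it)/(Γ(it)Γ(−it))) · K_{σ₁}(s₀, s; α, it) dt; in particular the right-hand side is independent of the admissible choice of σ₁. -/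

import Mathlib

open Complex MeasureTheory Set

/-- The K-Bessel function `K_μ(x) = ∫₀^∞ exp(−x cosh t) cosh(μt) dt`. -/
noncomputable def KBessel (μ : ℂ) (x : ℝ) : ℂ :=
  ∫ t in Ioi (0:ℝ), Complex.exp (-(x : ℂ) * (Real.cosh t : ℂ)) * Complex.cosh (μ * (t : ℂ))

/-- The GL(2) Whittaker function `W_μ(y) = 2√y K_μ(2πy)`. -/
noncomputable def W2 (μ : ℂ) (y : ℝ) : ℂ :=
  2 * (Real.sqrt y : ℂ) * KBessel μ (2 * Real.pi * y)

/-- The class `C_η` of test functions. -/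
def MemCeta (η : ℝ) (H : ℂ → ℂ) : Prop :=
  DifferentiableOn ℂ H {μ : ℂ | |μ.re| < 2 * η} ∧
  (∀ μ : ℂ, |μ.re| < 2 * η → H (-μ) = H μ) ∧
  ∃ C : ℝ, ∀ μ : ℂ, |μ.re| < 2 * η → ‖H μ‖ ≤ C * Real.exp (-2 * Real.pi * |μ.im|)

/-- The inverse Kontorovich–Lebedev transform. -/
noncomputable def Hflat (H : ℂ → ℂ) (y : ℝ) : ℂ :=
  (1 / (4 * (Real.pi : ℂ))) * ∫ t : ℝ,
    H (t * I) * W2 (t * I) y / (Complex.Gamma (t * I) * Complex.Gamma (-(t * I)))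

/-- Mellin transform `ĥ(w) := ∫₀^∞ h(y) y^{w−1} dy`. -/
noncomputable def mellinT (h : ℝ → ℂ) (w : ℂ) : ℂ :=
  ∫ y in Ioi (0:ℝ), h y * (y : ℂ) ^ (w - 1)

/-- The archimedean transform `(F_α H)(s₀, s)` (at `φ = π/2`, in its streamlined
Mellin–Barnes form), a double integral over `s₁ = (η − 1/2) + it₁` and
`u = 1/100 + iv`. -/
noncomputable def FtransMain (η : ℝ) (α : Fin 3 → ℂ) (H : ℂ → ℂ) (s0 s : ℂ) : ℂ :=
  (Real.sqrt Real.pi : ℂ) * (1 / (2 * (Real.pi : ℂ))) ^ 2 *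
    ∫ t1 : ℝ, ∫ v : ℝ,
      let s1 : ℂ := ((η : ℝ) - 1/2 : ℝ) + t1 * Complex.I
      let u : ℂ := 1/100 + v * Complex.I
      mellinT (Hflat H) (s - s1 - 1/2) * (Real.pi : ℂ) ^ (-s1) *
        ((∏ i, Complex.Gamma ((s1 - α i) / 2)) / Complex.Gamma ((1 + s1) / 2 - s0)) *
        (Complex.Gamma (u / 2) * Complex.Gamma ((s1 - s0 + u) / 2 + 1/2 - s) *
          (∏ i, Complex.Gamma ((s0 - u + α i) / 2)) * Complex.Gamma (s - (s0 + u) / 2)) /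
        (Complex.Gamma ((1 - u) / 2) * Complex.Gamma ((s0 - u + s1) / 2))

/-- The kernel `K_{σ₁}(s₀, s; α, μ)`, a double Mellin–Barnes integral over
`s₁ = σ₁ + it₁` and `u = 1/100 + iv`. -/
noncomputable def Kker (σ1 : ℝ) (s0 s : ℂ) (α : Fin 3 → ℂ) (μ : ℂ) : ℂ :=
  (1 / (2 * (Real.pi : ℂ))) ^ 2 *
    ∫ t1 : ℝ, ∫ v : ℝ,
      let s1 : ℂ := (σ1 : ℝ) + t1 * Complex.I
      let u : ℂ := 1/100 + v * Complex.I
      (Complex.Gamma ((s - s1 + μ) / 2) * Complex.Gamma ((s - s1 - μ) / 2) *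
        (∏ i, Complex.Gamma ((s1 - α i) / 2)) / Complex.Gamma ((1 + s1) / 2 - s0)) *
      (Complex.Gamma (u / 2) * Complex.Gamma ((s1 - s0 + u) / 2 + 1/2 - s) *
        (∏ i, Complex.Gamma ((s0 - u + α i) / 2)) * Complex.Gamma (s - (s0 + u) / 2)) /
      (Complex.Gamma ((1 - u) / 2) * Complex.Gamma ((s0 - u + s1) / 2))

open Filter Topology

theorem integrable_exp_neg_mul_abs {c : ℝ} (hc : 0 < c) :
    Integrable (fun x : ℝ => Real.exp (-c * |x|)) := by
  rw [← integrableOn_univ, ← Iic_union_Ioi (a := (0 : ℝ))]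
  refine IntegrableOn.union ?_ ?_
  · refine (integrableOn_exp_mul_Iic hc 0).congr_fun (fun x hx => ?_) measurableSet_Iic
    simp [abs_of_nonpos (mem_Iic.1 hx)]
  · refine (integrableOn_exp_mul_Ioi (neg_neg_of_pos hc) 0).congr_fun (fun x hx => ?_)
      measurableSet_Ioi
    simp [abs_of_pos (mem_Ioi.1 hx)]

theorem integrable_of_norm_le_exp {f : ℝ → ℂ} (hf : Continuous f) {C c : ℝ} (hc : 0 < c)
    (hbd : ∀ x, ‖f x‖ ≤ C * Real.exp (-c * |x|)) : Integrable f :=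
  ((integrable_exp_neg_mul_abs hc).const_mul C).mono' hf.aestronglyMeasurable
    (Eventually.of_forall hbd)

/-- Shifting a vertical line of integration inside a strip of holomorphy with exponential decay. -/
theorem integral_vertical_line_eq {f : ℂ → ℂ} {a b : ℝ} (hab : a ≤ b)
    (hf : DifferentiableOn ℂ f {z | a ≤ z.re ∧ z.re ≤ b}) {C c : ℝ} (hc : 0 < c)
    (hbd : ∀ z : ℂ, a ≤ z.re → z.re ≤ b → ‖f z‖ ≤ C * Real.exp (-c * |z.im|)) :
    ∫ y : ℝ, f (a + y * I) = ∫ y : ℝ, f (b + y * I) := by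
  have hint : ∀ x : ℝ, a ≤ x → x ≤ b → Integrable (fun y : ℝ => f (x + y * I)) := by
    intro x hx hx'
    refine integrable_of_norm_le_exp ?_ hc (C := C) (fun y => ?_)
    · refine hf.continuousOn.comp_continuous (by fun_prop) (fun y => ?_)
      simp [hx, hx']
    · simpa using hbd (x + y * I) (by simpa using hx) (by simpa using hx')
  have hT : Tendsto (fun T : ℝ => C * Real.exp (-c * T) * |b - a|) atTop (𝓝 0) := by
    have : Tendsto (fun T : ℝ => Real.exp (-c * T)) atTop (𝓝 0) :=
      Real.tendsto_exp_atBot.comp ((tendsto_const_mul_atBot_of_neg (by linarith)).2 tendsto_id)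
    simpa using (this.const_mul C).mul_const (|b - a|)
  have hhor : ∀ ε : ℝ, |ε| = 1 →
      Tendsto (fun T : ℝ => ∫ x in a..b, f (x + (ε * T : ℝ) * I)) atTop (𝓝 0) := by
    intro ε hε
    refine squeeze_zero_norm' ?_ hT
    filter_upwards [eventually_ge_atTop 0] with T hT0
    refine intervalIntegral.norm_integral_le_of_norm_le_const (fun x hx => ?_)
    rw [uIoc_of_le hab] at hx
    have := hbd (x + (ε * T : ℝ) * I) (by simpa using hx.1.le) (by simpa using hx.2)
    simpa [abs_mul, hε, abs_of_nonneg hT0] using this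
  have hver : ∀ x : ℝ, a ≤ x → x ≤ b → Tendsto (fun T : ℝ => ∫ y in (-T)..T, f (x + y * I)) atTop
      (𝓝 (∫ y : ℝ, f (x + y * I))) := fun x hx hx' =>
    intervalIntegral_tendsto_integral (hint x hx hx') tendsto_neg_atTop_atBot tendsto_id
  have hrect : ∀ T : ℝ, (∫ x in a..b, f (x + (-1 * T : ℝ) * I)) -
      (∫ x in a..b, f (x + (1 * T : ℝ) * I)) + I * (∫ y in (-T)..T, f (b + y * I)) -
      I * (∫ y in (-T)..T, f (a + y * I)) = 0 := by
    intro T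
    have := integral_boundary_rect_eq_zero_of_differentiableOn f ⟨a, -T⟩ ⟨b, T⟩
      (hf.mono (fun z hz => by
        rw [mem_reProdIm] at hz
        simpa [uIcc_of_le hab] using hz.1))
    simpa using this
  have hlim := (((hhor (-1) (by simp)).sub (hhor 1 (by simp))).add
    ((hver b hab le_rfl).const_mul I)).sub ((hver a le_rfl hab).const_mul I)
  have h0 := tendsto_nhds_unique (hlim.congr hrect) tendsto_const_nhds
  have : I * ((∫ y : ℝ, f (b + y * I)) - ∫ y : ℝ, f (a + y * I)) = 0 := by
    rw [← h0]; ring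
  rcases mul_eq_zero.1 this with h | h
  · exact absurd h I_ne_zero
  · exact (sub_eq_zero.1 h).symm

/-- Shifting a horizontal line of integration. -/
theorem integral_horizontal_line_eq {F : ℂ → ℂ} {Θ θ : ℝ} (hθ : |θ| ≤ Θ)
    (hF : Differentiable ℂ F) {C c : ℝ} (hc : 0 < c)
    (hbd : ∀ z : ℂ, |z.im| ≤ Θ → ‖F z‖ ≤ C * Real.exp (-c * |z.re|)) :
    ∫ y : ℝ, F (y + θ * I) = ∫ y : ℝ, F y := by
  have key : ∀ x : ℝ, |x| ≤ Θ → ∫ y : ℝ, F (y + (Θ : ℂ) * I) = ∫ y : ℝ, F (y + x * I) := by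
    intro x hx
    have := integral_vertical_line_eq (f := fun z => F (-I * z)) (a := -Θ) (b := -x)
      (by linarith [(abs_le.1 hx).2]) (by fun_prop) hc (C := C) (fun z h1 h2 => by
        have := hbd (-I * z) (by
          simp only [neg_mul, neg_im, mul_im, I_re, zero_mul, I_im, one_mul, zero_add, abs_neg]
          rw [abs_le]; constructor <;> linarith [(abs_le.1 hx).1])
        simpa using this)
    convert this using 4 with y y <;> push_cast <;> linear_combination (y : ℂ) * I_mul_I
  rw [← key θ hθ, key 0 (by simpa using (abs_nonneg θ).trans hθ)]
  simp

theorem Gamma_eq_integral_exp {z : ℂ} (hz : 0 < z.re) :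
    Gamma z = ∫ x : ℝ, exp (z * x - exp x) := by
  rw [Gamma_eq_integral hz, GammaIntegral]
  have himg : Set.image Real.exp univ = Ioi 0 := by rw [image_univ, Real.range_exp]
  rw [← himg, integral_image_eq_integral_abs_deriv_smul MeasurableSet.univ
    (fun x _ => (Real.hasDerivAt_exp x).hasDerivWithinAt) Real.exp_injective.injOn]
  rw [setIntegral_univ]
  congr 1 with x
  rw [abs_of_pos (Real.exp_pos x), real_smul]
  push_cast
  rw [cpow_def_of_ne_zero (exp_ne_zero _), ← ofReal_exp, ← ofReal_log (Real.exp_pos x).le,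
    Real.log_exp, ofReal_exp, mul_left_comm, ← exp_add, ← exp_add]
  ring_nf

/-- Exponential decay of the Gamma function along vertical lines, uniformly in strips. -/
theorem exists_norm_Gamma_le {a b Θ : ℝ} (ha : 0 < a) (hΘ0 : 0 ≤ Θ) (hΘ : Θ < Real.pi / 2) :
    ∃ C, 0 < C ∧ ∀ z : ℂ, a ≤ z.re → z.re ≤ b → ‖Gamma z‖ ≤ C * Real.exp (-Θ * |z.im|) := by
  have hcos : 0 < Real.cos Θ := Real.cos_pos_of_mem_Ioo ⟨by linarith [Real.pi_pos], hΘ⟩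
  obtain ⟨K, hK0, hK⟩ : ∃ K : ℝ, 0 < K ∧ ∀ x : ℝ, 0 ≤ x →
      (b + a) * x - Real.exp x * Real.cos Θ ≤ K := by
    refine ⟨2 * (b + a) ^ 2 / Real.cos Θ + 1, by positivity, fun x hx => ?_⟩
    have h1 : x ^ 2 / 2 ≤ Real.exp x := by
      have := Real.quadratic_le_exp_of_nonneg hx; linarith
    have h2 : x ^ 2 / 2 * Real.cos Θ ≤ Real.exp x * Real.cos Θ := by gcongr
    have h3 : (b + a) * x ≤ x ^ 2 / 2 * Real.cos Θ + 2 * (b + a) ^ 2 / Real.cos Θ := by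
      rw [← sub_nonneg]
      have : x ^ 2 / 2 * Real.cos Θ + 2 * (b + a) ^ 2 / Real.cos Θ - (b + a) * x =
        ((x * Real.cos Θ - (b + a)) ^ 2 + 3 * (b + a) ^ 2) / (2 * Real.cos Θ) := by
        field_simp; ring
      rw [this]; positivity
    linarith
  have hexp : ∀ σ x θ : ℝ, a ≤ σ → σ ≤ b → |θ| ≤ Θ →
      Real.exp (σ * x - Real.exp x * Real.cos θ) ≤ Real.exp K * Real.exp (-a * |x|) := by
    intro σ x θ h1 h2 hθ
    rw [← Real.exp_add]
    apply Real.exp_le_exp.2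
    have hc : Real.cos Θ ≤ Real.cos θ := by
      rw [← Real.cos_abs θ]
      exact Real.cos_le_cos_of_nonneg_of_le_pi (abs_nonneg _) (by linarith [Real.pi_pos]) hθ
    have hc' : Real.exp x * Real.cos Θ ≤ Real.exp x * Real.cos θ := by gcongr
    rcases le_total 0 x with hx | hx
    · rw [abs_of_nonneg hx]
      have := hK x hx
      have : σ * x ≤ b * x := by gcongr
      linarith
    · rw [abs_of_nonpos hx]
      have : 0 ≤ Real.exp x * Real.cos Θ := by positivity
      nlinarith
  refine ⟨Real.exp K * ∫ x : ℝ, Real.exp (-a * |x|), ?_, fun z h1 h2 => ?_⟩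
  · refine mul_pos (Real.exp_pos _) ?_
    exact integral_exp_pos (integrable_exp_neg_mul_abs ha)
  have hz : 0 < z.re := by linarith
  have main : ∀ θ : ℝ, |θ| ≤ Θ →
      ‖Gamma z‖ ≤ Real.exp K * (∫ x : ℝ, Real.exp (-a * |x|)) * Real.exp (-θ * z.im) := by
    intro θ hθ
    have hnorm : ∀ w : ℂ, ‖exp (z * w - exp w)‖ =
        Real.exp (z.re * w.re - Real.exp w.re * Real.cos w.im) * Real.exp (-w.im * z.im) := by
      intro w
      rw [norm_exp, ← Real.exp_add]
      congr 1
      simp only [sub_re, mul_re, exp_re]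
      ring
    rw [Gamma_eq_integral_exp hz, ← integral_horizontal_line_eq
      (F := fun w => exp (z * w - exp w)) (C := Real.exp K * Real.exp (Θ * |z.im|)) hθ (by fun_prop) ha]
    · rw [mul_assoc, mul_comm (∫ x : ℝ, _), ← integral_const_mul, ← integral_const_mul]
      refine norm_integral_le_of_norm_le
        (((integrable_exp_neg_mul_abs ha).const_mul _).const_mul _) (Eventually.of_forall fun x => ?_)
      rw [hnorm]
      have := hexp z.re x θ h1 h2 hθ
      simp only [add_re, ofReal_re, mul_re, I_re, mul_zero, ofReal_im, I_im, sub_self, add_zero,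
        add_im, mul_im, zero_add, mul_one]
      calc _ ≤ (Real.exp K * Real.exp (-a * |x|)) * Real.exp (-θ * z.im) := by gcongr
        _ = _ := by ring
    · intro w hw
      rw [hnorm]
      have := hexp z.re w.re w.im h1 h2 hw
      calc _ ≤ (Real.exp K * Real.exp (-a * |w.re|)) * Real.exp (Θ * |z.im|) := by
            refine mul_le_mul this (Real.exp_le_exp.2 ?_) (Real.exp_pos _).le (by positivity)
            calc -w.im * z.im ≤ |w.im * z.im| := by rw [neg_mul]; exact neg_le_abs _
              _ = |w.im| * |z.im| := abs_mul _ _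
              _ ≤ _ := by gcongr
        _ = _ := by ring
  rcases le_total 0 z.im with h | h
  · rw [abs_of_nonneg h]; exact main Θ (by rw [abs_of_nonneg hΘ0])
  · rw [abs_of_nonpos h, mul_neg, ← neg_mul]
    exact main (-Θ) (by rw [abs_neg, abs_of_nonneg hΘ0])

theorem norm_sin_le_exp (z : ℂ) : ‖sin z‖ ≤ Real.exp |z.im| := by
  rw [Complex.sin, norm_div, norm_mul, norm_I, mul_one, norm_ofNat, div_le_iff₀ two_pos]
  calc ‖exp (-z * I) - exp (z * I)‖ ≤ ‖exp (-z * I)‖ + ‖exp (z * I)‖ := norm_sub_le _ _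
    _ = Real.exp z.im + Real.exp (-z.im) := by simp [norm_exp]
    _ ≤ Real.exp |z.im| + Real.exp |z.im| := by
        gcongr
        · exact le_abs_self _
        · exact neg_le_abs _
    _ = _ := by ring

theorem continuous_Gamma_inv : Continuous fun z : ℂ => (Gamma z)⁻¹ :=
  differentiable_one_div_Gamma.continuous

/-- Growth of the reciprocal Gamma function along vertical lines, uniformly in strips. -/
theorem exists_norm_Gamma_inv_le (a b : ℝ) :
    ∃ C, 0 < C ∧ ∀ z : ℂ, a ≤ z.re → z.re ≤ b →
      ‖(Gamma z)⁻¹‖ ≤ C * Real.exp (8 / 5 * |z.im|) := by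
  suffices h : ∀ n : ℕ, ∀ a : ℝ, ∃ C, 0 < C ∧ ∀ z : ℂ, a ≤ z.re → z.re ≤ n + 1 / 2 →
      ‖(Gamma z)⁻¹‖ ≤ C * Real.exp (8 / 5 * |z.im|) by
    obtain ⟨n, hn⟩ := exists_nat_ge b
    obtain ⟨C, hC, hbd⟩ := h n a
    exact ⟨C, hC, fun z h1 h2 => hbd z h1 (by linarith)⟩
  intro n
  induction n with
  | zero =>
    intro a
    obtain ⟨C, hC, hbd⟩ := exists_norm_Gamma_le (a := 1 / 2) (b := 1 - a) (Θ := 31 / 20)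
      (by norm_num) (by norm_num) (by linarith [Real.pi_gt_d2])
    refine ⟨C / Real.pi, by positivity, fun z h1 h2 => ?_⟩
    have hz : (1 - z).re = 1 - z.re := by simp
    have hG := hbd (1 - z) (by rw [hz]; norm_num at h2; linarith) (by rw [hz]; linarith)
    have hne : Gamma (1 - z) ≠ 0 := Gamma_ne_zero_of_re_pos (by rw [hz]; norm_num at h2; linarith)
    have hrefl : (Gamma z)⁻¹ = Gamma (1 - z) * sin (Real.pi * z) / Real.pi := by
      have h := Gamma_mul_Gamma_one_sub z
      rw [eq_div_iff (ofReal_ne_zero.2 Real.pi_ne_zero), ← inv_inv (sin (Real.pi * z))]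
      have : (sin (Real.pi * z))⁻¹ = Gamma z * Gamma (1 - z) / Real.pi := by
        rw [h, div_right_comm, div_self (ofReal_ne_zero.2 Real.pi_ne_zero), one_div]
      rw [this]
      by_cases hz0 : Gamma z = 0
      · simp [hz0]
      · have := ofReal_ne_zero.2 Real.pi_ne_zero
        field_simp
    rw [hrefl, norm_div, norm_mul, norm_real, Real.norm_of_nonneg Real.pi_pos.le]
    have hs := norm_sin_le_exp (Real.pi * z)
    have him : ((Real.pi : ℂ) * z).im = Real.pi * z.im := by simp
    have him' : (1 - z).im = -z.im := by simp
    rw [him, abs_mul, abs_of_pos Real.pi_pos] at hs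
    rw [him', abs_neg] at hG
    rw [div_mul_eq_mul_div]
    refine div_le_div_of_nonneg_right ?_ Real.pi_pos.le
    calc _ ≤ C * Real.exp (-(31 / 20) * |z.im|) * Real.exp (Real.pi * |z.im|) := by gcongr
      _ = C * Real.exp ((Real.pi - 31 / 20) * |z.im|) := by
          rw [mul_assoc, ← Real.exp_add]; ring_nf
      _ ≤ _ := by
          gcongr
          linarith [Real.pi_lt_d2]
  | succ n ih =>
    intro a
    obtain ⟨C, hC, hbd⟩ := ih (a - 1)
    obtain ⟨D, hD⟩ := (isCompact_Icc.reProdIm isCompact_Icc :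
      IsCompact (Icc a (n + 1 + 1 / 2) ×ℂ Icc (-1) 1)).exists_bound_of_continuousOn
      continuous_Gamma_inv.continuousOn
    refine ⟨max C D, lt_max_of_lt_left hC, fun z h1 h2 => ?_⟩
    push_cast at h2
    by_cases him : |z.im| ≤ 1
    · calc _ ≤ D := hD z (by rw [mem_reProdIm]; exact ⟨⟨h1, h2⟩, abs_le.1 him⟩)
        _ ≤ max C D * 1 := by simp
        _ ≤ _ := by
          gcongr
          exact Real.one_le_exp (by positivity)
    · push Not at him
      have h := one_div_Gamma_eq_self_mul_one_div_Gamma_add_one (z - 1)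
      rw [sub_add_cancel] at h
      have hz1 : 1 ≤ ‖z - 1‖ := by
        have := abs_im_le_norm (z - 1)
        simp only [sub_im, one_im, sub_zero] at this
        linarith
      have hle : ‖(Gamma z)⁻¹‖ ≤ ‖(Gamma (z - 1))⁻¹‖ := by
        rw [h, norm_mul]
        exact le_mul_of_one_le_left (norm_nonneg _) hz1
      have := hbd (z - 1) (by simpa using h1) (by simp; linarith)
      simp only [sub_im, one_im, sub_zero] at this
      calc _ ≤ _ := hle
        _ ≤ _ := this
        _ ≤ _ := by gcongr; exact le_max_left _ _

theorem integral_exp_mul_cosh_cpow {z μ : ℂ} (h1 : 0 < (z + μ).re) (h2 : 0 < (z - μ).re) :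
    ∫ r : ℝ, exp (μ * r) * (Real.cosh r : ℂ) ^ (-z) =
      2 ^ (z - 1) * (Gamma ((z + μ) / 2) * Gamma ((z - μ) / 2)) / Gamma z := by
  have hdiv : ∀ w : ℂ, (w / 2).re = w.re / 2 := fun w => by
    simp
  have h1' : 0 < ((z + μ) / 2).re := by rw [hdiv]; positivity
  have h2' : 0 < ((z - μ) / 2).re := by rw [hdiv]; positivity
  have hbeta := betaIntegral_eq_Gamma_mul_div _ _ h1' h2'
  rw [show (z + μ) / 2 + (z - μ) / 2 = z by ring] at hbeta
  rw [mul_div_assoc, ← hbeta, betaIntegral, intervalIntegral.integral_of_le zero_le_one,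
    integral_Ioc_eq_integral_Ioo, ← Real.range_sigmoid, ← image_univ,
    integral_image_eq_integral_abs_deriv_smul MeasurableSet.univ
    (fun x _ => (Real.hasDerivAt_sigmoid x).hasDerivWithinAt) Real.sigmoid_injective.injOn,
    setIntegral_univ]
  have hsub := Measure.integral_comp_mul_left (fun x : ℝ => |x.sigmoid * (1 - x.sigmoid)| •
    ((x.sigmoid : ℂ) ^ ((z + μ) / 2 - 1) * (1 - (x.sigmoid : ℂ)) ^ ((z - μ) / 2 - 1))) 2
  have hval : ∫ x : ℝ, |x.sigmoid * (1 - x.sigmoid)| •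
      ((x.sigmoid : ℂ) ^ ((z + μ) / 2 - 1) * (1 - (x.sigmoid : ℂ)) ^ ((z - μ) / 2 - 1)) =
      2 * ∫ r : ℝ, 2 ^ (-z) * (exp (μ * r) * (Real.cosh r : ℂ) ^ (-z)) := by
    rw [show |(2 : ℝ)⁻¹| = 2⁻¹ by norm_num] at hsub
    rw [← inv_mul_eq_iff_eq_mul₀ (two_ne_zero (α := ℂ))]
    rw [real_smul] at hsub
    push_cast at hsub
    rw [← hsub]
    congr 1 with r
    have hs := Real.sigmoid_pos (2 * r)
    have hs1 : 0 < 1 - Real.sigmoid (2 * r) := by linarith [Real.sigmoid_lt_one (2 * r)]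
    have hch := Real.cosh_pos r
    have e : ∀ r : ℝ, Real.log (Real.sigmoid (2 * r)) = r - Real.log (2 * Real.cosh r) := by
      intro r
      have hch := Real.cosh_pos r
      have : Real.sigmoid (2 * r) = Real.exp r / (2 * Real.cosh r) := by
        rw [Real.sigmoid_def, Real.cosh_eq, eq_div_iff (by positivity), inv_mul_eq_div,
          div_eq_iff (by positivity), mul_add, mul_one, ← Real.exp_add]
        ring_nf
      rw [this, Real.log_div (Real.exp_pos _).ne' (by positivity), Real.log_exp]
    have e1 := e r
    have e2 : Real.log (1 - Real.sigmoid (2 * r)) = -r - Real.log (2 * Real.cosh r) := by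
      rw [← Real.sigmoid_neg, ← mul_neg, e, Real.cosh_neg]
    rw [abs_of_pos (mul_pos hs hs1), real_smul]
    have c1 : (Real.sigmoid (2 * r) : ℂ) ≠ 0 := ofReal_ne_zero.2 hs.ne'
    have c2 : (1 - Real.sigmoid (2 * r) : ℂ) ≠ 0 := by exact_mod_cast hs1.ne'
    calc _ = ((Real.sigmoid (2 * r) : ℂ) ^ ((z + μ) / 2 - 1) * Real.sigmoid (2 * r)) *
          ((1 - Real.sigmoid (2 * r) : ℂ) ^ ((z - μ) / 2 - 1) * (1 - Real.sigmoid (2 * r))) := by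
            push_cast; ring
      _ = (Real.sigmoid (2 * r) : ℂ) ^ ((z + μ) / 2) *
          ((1 - Real.sigmoid (2 * r) : ℝ) : ℂ) ^ ((z - μ) / 2) := by
            rw [cpow_sub _ _ c1, cpow_one, div_mul_cancel₀ _ c1, cpow_sub _ _ c2, cpow_one,
              div_mul_cancel₀ _ c2]
            push_cast; rfl
      _ = _ := by
            have h2c : ((2 * Real.cosh r : ℝ) : ℂ) ^ (-z) = 2 ^ (-z) * (Real.cosh r : ℂ) ^ (-z) := by
              rw [ofReal_mul, mul_cpow_ofReal_nonneg two_pos.le hch.le]; simp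
            rw [mul_left_comm, ← h2c, cpow_def_of_ne_zero c1,
              cpow_def_of_ne_zero (ofReal_ne_zero.2 hs1.ne'),
              cpow_def_of_ne_zero (ofReal_ne_zero.2 (by positivity)),
              ← ofReal_log hs.le, ← ofReal_log hs1.le, ← ofReal_log (by positivity), e1, e2,
              ← exp_add, ← exp_add]
            push_cast
            ring_nf
  rw [hval, integral_const_mul, ← mul_assoc, ← mul_assoc, cpow_sub _ _ two_ne_zero, cpow_one,
    div_mul_cancel₀ _ (two_ne_zero (α := ℂ)), ← cpow_add _ _ two_ne_zero, add_neg_cancel, cpow_zero,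
    one_mul]

theorem exp_abs_le_two_mul_cosh (r : ℝ) : Real.exp |r| ≤ 2 * Real.cosh r := by
  rw [← Real.cosh_abs, Real.cosh_eq]
  linarith [Real.exp_pos (-|r|)]

theorem cosh_le_exp_abs (r : ℝ) : Real.cosh r ≤ Real.exp |r| := by
  have : Real.exp (-|r|) ≤ Real.exp |r| := Real.exp_le_exp.2 (by linarith [abs_nonneg r])
  rw [← Real.cosh_abs, Real.cosh_eq]
  linarith

theorem norm_cosh_cpow_neg_le (z : ℂ) (hz : 0 ≤ z.re) (r : ℝ) :
    ‖(Real.cosh r : ℂ) ^ (-z)‖ ≤ 2 ^ z.re * Real.exp (-z.re * |r|) := by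
  have h := exp_abs_le_two_mul_cosh r
  have hc := Real.cosh_pos r
  rw [norm_cpow_eq_rpow_re_of_pos hc, neg_re, Real.rpow_neg hc.le,
    inv_le_comm₀ (by positivity) (by positivity), mul_inv, ← Real.exp_neg,
    inv_mul_le_iff₀ (by positivity), ← Real.mul_rpow zero_le_two hc.le, neg_mul, neg_neg,
    mul_comm, Real.exp_mul]
  exact Real.rpow_le_rpow (Real.exp_pos _).le h hz

theorem continuous_cosh_cpow (z : ℂ) : Continuous fun r : ℝ => (Real.cosh r : ℂ) ^ z := by
  refine Continuous.cpow (by fun_prop) continuous_const (fun r => ?_)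
  exact ofReal_mem_slitPlane.2 (Real.cosh_pos r)

/-- The holomorphic form of `H(μ) / (Γ(μ)Γ(−μ))`. -/
noncomputable def spectralDensity (H : ℂ → ℂ) (μ : ℂ) : ℂ :=
  -(H μ * (μ * sin (Real.pi * μ))) / Real.pi

theorem div_Gamma_mul_Gamma_neg (H : ℂ → ℂ) (μ : ℂ) :
    H μ / (Gamma μ * Gamma (-μ)) = spectralDensity H μ := by
  have hpi : (Real.pi : ℂ) ≠ 0 := ofReal_ne_zero.2 Real.pi_ne_zero
  rw [spectralDensity]
  rcases eq_or_ne μ 0 with rfl | hμ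
  · simp
  have h := Gamma_mul_Gamma_one_sub μ
  rw [show 1 - μ = -μ + 1 by ring, Gamma_add_one _ (neg_ne_zero.2 hμ)] at h
  have h' : Gamma μ * Gamma (-μ) = -(Real.pi / sin (Real.pi * μ)) / μ := by
    rw [← h]; field_simp
  rw [h', div_div_eq_mul_div, div_neg, div_div_eq_mul_div]
  ring

theorem spectralDensity_intCast (H : ℂ → ℂ) (k : ℤ) : spectralDensity H k = 0 := by
  rw [spectralDensity, mul_comm (Real.pi : ℂ), sin_int_mul_pi]
  simp

theorem differentiableOn_spectralDensity {η : ℝ} {H : ℂ → ℂ} (hH : MemCeta η H) :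
    DifferentiableOn ℂ (spectralDensity H) {μ : ℂ | |μ.re| < 2 * η} := by
  unfold spectralDensity
  have := hH.1
  fun_prop

theorem exists_norm_spectralDensity_le {η : ℝ} {H : ℂ → ℂ} (hH : MemCeta η H) :
    ∃ C, 0 < C ∧ ∀ μ : ℂ, |μ.re| < 2 * η →
      ‖spectralDensity H μ‖ ≤ C * Real.exp (-1 * |μ.im|) := by
  obtain ⟨-, -, C₀, hC₀⟩ := hH
  refine ⟨(|C₀| + 1) * (2 * |η| + 1) / Real.pi, by positivity, fun μ hμ => ?_⟩
  have h1 : ‖H μ‖ ≤ (|C₀| + 1) * Real.exp (-2 * Real.pi * |μ.im|) := by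
    refine (hC₀ μ hμ).trans ?_
    gcongr
    linarith [le_abs_self C₀]
  have h2 : ‖sin (Real.pi * μ)‖ ≤ Real.exp (Real.pi * |μ.im|) := by
    have := norm_sin_le_exp (Real.pi * μ)
    simpa [abs_mul, abs_of_pos Real.pi_pos] using this
  have h3 : ‖μ‖ ≤ (2 * |η| + 1) * Real.exp |μ.im| := by
    have e1 := Real.add_one_le_exp |μ.im|
    have e2 := norm_le_abs_re_add_abs_im μ
    have e3 := le_abs_self η
    nlinarith [abs_nonneg η, abs_nonneg μ.im]
  rw [spectralDensity, norm_div, norm_neg, norm_mul, norm_mul, norm_real,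
    Real.norm_of_nonneg Real.pi_pos.le, div_mul_eq_mul_div]
  refine div_le_div_of_nonneg_right ?_ Real.pi_pos.le
  calc _ ≤ (|C₀| + 1) * Real.exp (-2 * Real.pi * |μ.im|) *
        ((2 * |η| + 1) * Real.exp |μ.im| * Real.exp (Real.pi * |μ.im|)) := by gcongr
    _ = (|C₀| + 1) * (2 * |η| + 1) * Real.exp ((1 - Real.pi) * |μ.im|) := by
        rw [show (1 - Real.pi) * |μ.im| = -2 * Real.pi * |μ.im| + (|μ.im| + Real.pi * |μ.im|) by ring,
          Real.exp_add, Real.exp_add]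
        ring
    _ ≤ _ := by
        gcongr
        linarith [Real.pi_gt_d2]

/-- The Fourier transform of `Φ` along the imaginary axis. -/
noncomputable def lineFourier (Φ : ℂ → ℂ) (r : ℝ) : ℂ :=
  ∫ t : ℝ, Φ (t * I) * exp (t * I * r)

section LineFourier

variable {Φ : ℂ → ℂ} {A C : ℝ}

theorem continuous_line (hd : DifferentiableOn ℂ Φ {μ : ℂ | |μ.re| < A}) {x : ℝ} (hx : |x| < A) :
    Continuous fun t : ℝ => Φ (x + t * I) :=
  hd.continuousOn.comp_continuous (by fun_prop) (fun t => by simpa using hx)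

theorem integrable_line (hd : DifferentiableOn ℂ Φ {μ : ℂ | |μ.re| < A})
    (hb : ∀ μ : ℂ, |μ.re| < A → ‖Φ μ‖ ≤ C * Real.exp (-1 * |μ.im|)) {x : ℝ} (hx : |x| < A) :
    Integrable fun t : ℝ => Φ (x + t * I) :=
  integrable_of_norm_le_exp (continuous_line hd hx) one_pos
    (fun t => by simpa using hb (x + t * I) (by simpa using hx))

theorem integrable_imaginary_axis (hA : 0 < A) (hd : DifferentiableOn ℂ Φ {μ : ℂ | |μ.re| < A})
    (hb : ∀ μ : ℂ, |μ.re| < A → ‖Φ μ‖ ≤ C * Real.exp (-1 * |μ.im|)) :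
    Integrable fun t : ℝ => Φ (t * I) := by
  simpa using integrable_line hd hb (x := 0) (by simpa using hA)

theorem lineFourier_eq_shift (hd : DifferentiableOn ℂ Φ {μ : ℂ | |μ.re| < A})
    (hb : ∀ μ : ℂ, |μ.re| < A → ‖Φ μ‖ ≤ C * Real.exp (-1 * |μ.im|)) {x : ℝ} (hx : |x| < A)
    (r : ℝ) : lineFourier Φ r = ∫ t : ℝ, Φ (x + t * I) * exp ((x + t * I) * r) := by
  have hC : 0 ≤ C := by
    have := (norm_nonneg _).trans (hb 0 (by simpa using (abs_nonneg x).trans_lt hx))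
    simpa using this
  have key : ∀ y : ℝ, |y| ≤ |x| →
      ∫ t : ℝ, Φ ((-|x| : ℝ) + t * I) * exp (((-|x| : ℝ) + t * I) * r) =
        ∫ t : ℝ, Φ (y + t * I) * exp ((y + t * I) * r) := by
    intro y hy
    have hsub : ∀ z : ℂ, -|x| ≤ z.re → z.re ≤ y → |z.re| ≤ |x| := fun z h1 h2 =>
      abs_le.2 ⟨h1, h2.trans (abs_le.1 hy).2⟩
    refine integral_vertical_line_eq (f := fun μ => Φ μ * exp (μ * r)) (abs_le.1 hy).1 ?_
      one_pos (C := C * Real.exp (|x| * |r|)) (fun z h1 h2 => ?_)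
    · exact (hd.mono fun z hz => (hsub z hz.1 hz.2).trans_lt hx).mul (by fun_prop)
    · have hz := hsub z h1 h2
      rw [norm_mul, norm_exp]
      calc _ ≤ (C * Real.exp (-1 * |z.im|)) * Real.exp (|x| * |r|) := by
            refine mul_le_mul (hb z (hz.trans_lt hx)) (Real.exp_le_exp.2 ?_) (Real.exp_pos _).le
              (by positivity)
            rw [re_mul_ofReal]
            refine (le_abs_self _).trans ?_
            rw [abs_mul]
            gcongr
        _ = _ := by ring
  rw [← key x le_rfl, key 0 (by simp), lineFourier]
  simp

theorem exists_norm_lineFourier_le (hd : DifferentiableOn ℂ Φ {μ : ℂ | |μ.re| < A})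
    (hb : ∀ μ : ℂ, |μ.re| < A → ‖Φ μ‖ ≤ C * Real.exp (-1 * |μ.im|)) {B : ℝ} (hB0 : 0 ≤ B)
    (hB : B < A) : ∃ D, 0 < D ∧ ∀ r : ℝ, ‖lineFourier Φ r‖ ≤ D * Real.exp (-B * |r|) := by
  have hC : 0 ≤ C := by
    have := (norm_nonneg _).trans (hb 0 (by simpa using hB0.trans_lt hB))
    simpa using this
  have main : ∀ x r : ℝ, |x| < A → ‖lineFourier Φ r‖ ≤
      ((C + 1) * ∫ t : ℝ, Real.exp (-1 * |t|)) * Real.exp (x * r) := by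
    intro x r hx
    rw [lineFourier_eq_shift hd hb hx, ← integral_const_mul, ← integral_mul_const]
    refine norm_integral_le_of_norm_le
      (((integrable_exp_neg_mul_abs one_pos).const_mul _).mul_const _)
      (Eventually.of_forall fun t => ?_)
    rw [norm_mul, norm_exp, re_mul_ofReal]
    have := hb (x + t * I) (by simpa using hx)
    simp only [add_re, ofReal_re, mul_re, I_re, mul_zero, ofReal_im, I_im, sub_self, add_zero,
      add_im, mul_im, zero_add, mul_one] at this ⊢
    gcongr
    refine this.trans ?_
    gcongr
    linarith
  refine ⟨(C + 1) * ∫ t : ℝ, Real.exp (-1 * |t|),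
    mul_pos (by linarith) (integral_exp_pos (integrable_exp_neg_mul_abs one_pos)), fun r => ?_⟩
  rcases le_total 0 r with h | h
  · rw [abs_of_nonneg h]
    exact main (-B) r (by rwa [abs_neg, abs_of_nonneg hB0])
  · rw [abs_of_nonpos h, neg_mul_neg]
    exact main B r (by rwa [abs_of_nonneg hB0])

theorem continuous_lineFourier (hΦ : Integrable fun t : ℝ => Φ (t * I)) :
    Continuous (lineFourier Φ) := by
  refine continuous_of_dominated (bound := fun t => ‖Φ (t * I)‖) (fun r => ?_) (fun r => ?_)
    hΦ.norm ?_
  · exact hΦ.aestronglyMeasurable.mul (Continuous.aestronglyMeasurable (by fun_prop))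
  · refine Eventually.of_forall fun t => ?_
    simp [norm_exp]
  · exact Eventually.of_forall fun t => by fun_prop

theorem integrable_lineFourier_mul (hA : 0 < A)
    (hd : DifferentiableOn ℂ Φ {μ : ℂ | |μ.re| < A})
    (hb : ∀ μ : ℂ, |μ.re| < A → ‖Φ μ‖ ≤ C * Real.exp (-1 * |μ.im|)) {B K : ℝ} (hB0 : 0 ≤ B)
    (hB : B < A) {g : ℝ → ℂ} (hg : Continuous g) (hgb : ∀ r, ‖g r‖ ≤ K * Real.exp (B * |r|)) :
    Integrable fun r : ℝ => lineFourier Φ r * g r := by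
  obtain ⟨D, hD, hDb⟩ := exists_norm_lineFourier_le hd hb (B := (A + B) / 2) (by linarith)
    (by linarith)
  refine integrable_of_norm_le_exp ((continuous_lineFourier
    (integrable_imaginary_axis hA hd hb)).mul hg) (C := D * K) (c := (A - B) / 2) (by linarith)
    (fun r => ?_)
  rw [norm_mul]
  calc _ ≤ (D * Real.exp (-((A + B) / 2) * |r|)) * (K * Real.exp (B * |r|)) := by
        gcongr
        · exact hDb r
        · exact hgb r
    _ = D * K * (Real.exp (-((A + B) / 2) * |r|) * Real.exp (B * |r|)) := by ring
    _ = _ := by rw [← Real.exp_add]; ring_nf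

open FourierTransform in
theorem integral_lineFourier_mul_exp (hd : DifferentiableOn ℂ Φ {μ : ℂ | |μ.re| < A})
    (hb : ∀ μ : ℂ, |μ.re| < A → ‖Φ μ‖ ≤ C * Real.exp (-1 * |μ.im|)) {x : ℝ} (hx : |x| < A)
    (hzero : Φ x = 0) : ∫ r : ℝ, lineFourier Φ r * exp (-x * r) = 0 := by
  set f : ℝ → ℂ := fun t => Φ (x + t * I) with hf
  have hA : 0 < A := (abs_nonneg x).trans_lt hx
  have hF : ∀ ξ : ℝ, 𝓕 f ξ =
      lineFourier Φ (-2 * Real.pi * ξ) * exp (-x * (-2 * Real.pi * ξ : ℝ)) := by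
    intro ξ
    rw [lineFourier_eq_shift hd hb hx, Real.fourier_eq', ← integral_mul_const]
    congr 1 with t
    rw [smul_eq_mul, mul_assoc (Φ _), ← exp_add, mul_comm]
    simp only [hf, RCLike.inner_apply, conj_trivial]
    push_cast
    ring_nf
  have hint : Integrable fun r : ℝ => lineFourier Φ r * exp (-x * r) := by
    refine integrable_lineFourier_mul hA hd hb (abs_nonneg x) hx (K := 1) (by fun_prop)
      (fun r => ?_)
    rw [norm_exp, one_mul]
    apply Real.exp_le_exp.2
    rw [re_mul_ofReal, ← abs_mul]
    simpa using neg_le_abs (x * r)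
  have hne : -2 * Real.pi ≠ 0 := by simp [Real.pi_ne_zero]
  have hint' : Integrable (𝓕 f) := by
    rw [funext hF]
    exact hint.comp_mul_left' hne
  have hinv := (integrable_line hd hb hx).fourierInv_fourier_eq hint'
    (continuous_line hd hx).continuousAt (v := 0)
  rw [Real.fourierInv_eq'] at hinv
  simp only [inner_zero_right, mul_zero, ofReal_zero, zero_mul, exp_zero, one_smul, add_zero,
    hzero] at hinv
  rw [funext hF, Measure.integral_comp_mul_left
    (fun r : ℝ => lineFourier Φ r * exp (-x * r)) (-2 * Real.pi)] at hinv
  exact (smul_eq_zero.1 hinv).resolve_left (abs_pos.2 (inv_ne_zero hne)).ne'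

theorem cosh_pow_eq_sum (r : ℝ) (k : ℕ) : (Real.cosh r : ℂ) ^ k =
    ∑ m ∈ Finset.range (k + 1), ((k.choose m : ℂ) / 2 ^ k) *
      exp (-((k - 2 * m : ℤ) : ℝ) * r) := by
  rw [ofReal_cosh, Complex.cosh, div_pow, add_pow, Finset.sum_div]
  refine Finset.sum_congr rfl fun m hm => ?_
  have hm' : m ≤ k := Nat.lt_succ_iff.1 (Finset.mem_range.1 hm)
  rw [← exp_nat_mul, ← exp_nat_mul, ← exp_add, Nat.cast_sub hm']
  push_cast
  ring_nf

theorem integral_lineFourier_mul_cosh_pow (hd : DifferentiableOn ℂ Φ {μ : ℂ | |μ.re| < A})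
    (hb : ∀ μ : ℂ, |μ.re| < A → ‖Φ μ‖ ≤ C * Real.exp (-1 * |μ.im|))
    (hzero : ∀ k : ℤ, Φ k = 0) {k : ℕ} (hk : (k : ℝ) < A) :
    ∫ r : ℝ, lineFourier Φ r * (Real.cosh r : ℂ) ^ k = 0 := by
  have hA : 0 < A := (Nat.cast_nonneg k).trans_lt hk
  have hsum : ∀ r : ℝ, lineFourier Φ r * (Real.cosh r : ℂ) ^ k =
      ∑ m ∈ Finset.range (k + 1), ((k.choose m : ℂ) / 2 ^ k) *
        (lineFourier Φ r * exp (-((k - 2 * m : ℤ) : ℝ) * r)) := by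
    intro r
    rw [cosh_pow_eq_sum, Finset.mul_sum]
    exact Finset.sum_congr rfl fun m _ => mul_left_comm _ _ _
  simp_rw [hsum]
  have habs : ∀ m ∈ Finset.range (k + 1), |((k - 2 * m : ℤ) : ℝ)| < A := by
    intro m hm
    have hm' : (m : ℝ) ≤ k := by exact_mod_cast Nat.lt_succ_iff.1 (Finset.mem_range.1 hm)
    have hm0 : (0 : ℝ) ≤ m := Nat.cast_nonneg m
    push_cast
    rw [abs_lt]
    constructor <;> linarith
  rw [integral_finsetSum]
  · refine Finset.sum_eq_zero fun m hm => ?_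
    rw [integral_const_mul, integral_lineFourier_mul_exp hd hb (habs m hm), mul_zero]
    exact_mod_cast hzero _
  · intro m hm
    refine (integrable_lineFourier_mul hA hd hb (abs_nonneg _) (habs m hm) (K := 1) (by fun_prop)
      (fun r => ?_)).const_mul _
    rw [norm_exp, one_mul]
    apply Real.exp_le_exp.2
    rw [re_mul_ofReal, ← abs_mul, neg_re, ofReal_re, neg_mul]
    exact neg_le_abs _

end LineFourier

theorem exists_norm_exp_neg_sub_sum_le (N : ℕ) : ∃ K, 0 ≤ K ∧ ∀ x : ℝ, 0 ≤ x →
    ‖exp (-x) - ∑ k ∈ Finset.range N, (-x : ℂ) ^ k / k.factorial‖ ≤ K * x ^ N := by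
  refine ⟨Real.exp 1 + (1 + ∑ k ∈ Finset.range N, 1 / (k.factorial : ℝ)), by positivity,
    fun x hx => ?_⟩
  have hS : 0 ≤ ∑ k ∈ Finset.range N, 1 / (k.factorial : ℝ) := by positivity
  rw [add_mul]
  rcases le_total x 1 with h | h
  · have := norm_exp_sub_sum_le_norm_mul_exp (-x : ℂ) N
    rw [norm_neg, norm_real, Real.norm_of_nonneg hx] at this
    refine this.trans ?_
    rw [mul_comm]
    have h1 : Real.exp x * x ^ N ≤ Real.exp 1 * x ^ N := by gcongr
    have h2 : 0 ≤ (1 + ∑ k ∈ Finset.range N, 1 / (k.factorial : ℝ)) * x ^ N := by positivity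
    linarith
  · have hx1 : 1 ≤ x ^ N := one_le_pow₀ h
    have h1 : ‖exp (-x : ℂ)‖ ≤ x ^ N := by
      rw [norm_exp]
      refine le_trans (Real.exp_le_one_iff.2 ?_) hx1
      simpa using hx
    have h2 : ‖∑ k ∈ Finset.range N, (-x : ℂ) ^ k / k.factorial‖ ≤
        (∑ k ∈ Finset.range N, 1 / (k.factorial : ℝ)) * x ^ N := by
      rw [Finset.sum_mul]
      refine norm_sum_le_of_le _ fun k hk => ?_
      rw [norm_div, norm_pow, norm_neg, norm_real, Real.norm_of_nonneg hx, norm_natCast,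
        one_div_mul_eq_div]
      gcongr
      exact (Finset.mem_range.1 hk).le
    have h3 : 0 ≤ Real.exp 1 * x ^ N := by positivity
    refine (norm_sub_le _ _).trans ?_
    rw [add_mul, one_mul]
    linarith

/-- The integral of `lineFourier Φ` against `exp (-x cosh r)`. -/
noncomputable def coshLaplace (Φ : ℂ → ℂ) (x : ℝ) : ℂ :=
  ∫ r : ℝ, lineFourier Φ r * exp (-(x : ℂ) * (Real.cosh r : ℂ))

theorem norm_exp_neg_mul_cosh (x r : ℝ) :
    ‖exp (-(x : ℂ) * (Real.cosh r : ℂ))‖ = Real.exp (-x * Real.cosh r) := by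
  rw [norm_exp, re_mul_ofReal, neg_re, ofReal_re]

theorem exp_neg_mul_cosh_le {x : ℝ} (hx : 0 ≤ x) (r : ℝ) :
    Real.exp (-x * Real.cosh r) ≤ Real.exp (-x) := by
  apply Real.exp_le_exp.2
  nlinarith [Real.one_le_cosh r]

theorem integrable_exp_neg_mul_cosh {x : ℝ} (hx : 0 < x) :
    Integrable fun r : ℝ => exp (-(x : ℂ) * (Real.cosh r : ℂ)) := by
  refine integrable_of_norm_le_exp (by fun_prop) hx (C := 1) (fun r => ?_)
  rw [norm_exp_neg_mul_cosh, one_mul]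
  apply Real.exp_le_exp.2
  have h1 : |r| ≤ Real.cosh r := by
    rw [← Real.cosh_abs]
    exact (Real.self_le_sinh_iff.2 (abs_nonneg r)).trans (Real.sinh_lt_cosh _).le
  nlinarith

section CoshLaplace

variable {Φ : ℂ → ℂ} {A C : ℝ}

theorem integrable_lineFourier (hA : 0 < A) (hd : DifferentiableOn ℂ Φ {μ : ℂ | |μ.re| < A})
    (hb : ∀ μ : ℂ, |μ.re| < A → ‖Φ μ‖ ≤ C * Real.exp (-1 * |μ.im|)) :
    Integrable (lineFourier Φ) := by
  simpa using integrable_lineFourier_mul hA hd hb le_rfl hA (K := 1) (g := fun _ => 1)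
    (by fun_prop) (fun r => by simp)

theorem exists_norm_coshLaplace_le_pow (hd : DifferentiableOn ℂ Φ {μ : ℂ | |μ.re| < A})
    (hb : ∀ μ : ℂ, |μ.re| < A → ‖Φ μ‖ ≤ C * Real.exp (-1 * |μ.im|))
    (hzero : ∀ k : ℤ, Φ k = 0) {N : ℕ} (hN : (N : ℝ) < A) :
    ∃ D, 0 ≤ D ∧ ∀ x : ℝ, 0 ≤ x → ‖coshLaplace Φ x‖ ≤ D * x ^ N := by
  have hA : 0 < A := (Nat.cast_nonneg N).trans_lt hN
  obtain ⟨K, hK, hKb⟩ := exists_norm_exp_neg_sub_sum_le N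
  have hint : ∀ k ≤ N, Integrable fun r : ℝ => lineFourier Φ r * (Real.cosh r : ℂ) ^ k := by
    intro k hk
    refine integrable_lineFourier_mul hA hd hb (Nat.cast_nonneg N) hN (K := 1) (by fun_prop)
      (fun r => ?_)
    rw [norm_pow, norm_real, Real.norm_of_nonneg (Real.cosh_pos r).le, one_mul, Real.exp_nat_mul]
    calc _ ≤ Real.cosh r ^ N := pow_le_pow_right₀ (Real.one_le_cosh r) hk
      _ ≤ _ := by
        gcongr
        exact cosh_le_exp_abs r
  refine ⟨K * ∫ r : ℝ, ‖lineFourier Φ r * (Real.cosh r : ℂ) ^ N‖,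
    mul_nonneg hK (integral_nonneg fun _ => norm_nonneg _), fun x hx => ?_⟩
  have hterm : ∀ k ≤ N, Integrable fun r : ℝ =>
      ((-x : ℂ) ^ k / k.factorial) * (lineFourier Φ r * (Real.cosh r : ℂ) ^ k) :=
    fun k hk => (hint k hk).const_mul _
  have hsum : ∫ r : ℝ, ∑ k ∈ Finset.range N,
      ((-x : ℂ) ^ k / k.factorial) * (lineFourier Φ r * (Real.cosh r : ℂ) ^ k) = 0 := by
    rw [integral_finsetSum _ fun k hk => hterm k (Finset.mem_range.1 hk).le]
    refine Finset.sum_eq_zero fun k hk => ?_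
    have hkN : (k : ℝ) < N := by exact_mod_cast Finset.mem_range.1 hk
    rw [integral_const_mul, integral_lineFourier_mul_cosh_pow hd hb hzero (hkN.trans hN), mul_zero]
  have hexp : Integrable fun r : ℝ => lineFourier Φ r * exp (-(x : ℂ) * (Real.cosh r : ℂ)) := by
    refine integrable_lineFourier_mul hA hd hb le_rfl hA (K := 1) (by fun_prop) (fun r => ?_)
    rw [norm_exp_neg_mul_cosh, zero_mul, Real.exp_zero, one_mul]
    exact (exp_neg_mul_cosh_le hx r).trans (Real.exp_le_one_iff.2 (by linarith))
  rw [coshLaplace, ← sub_zero (∫ r : ℝ, _), ← hsum, ← integral_sub hexp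
    (integrable_finsetSum _ fun k hk => hterm k (Finset.mem_range.1 hk).le),
    mul_right_comm, ← integral_const_mul]
  refine norm_integral_le_of_norm_le ((hint N le_rfl).norm.const_mul _)
    (Eventually.of_forall fun r => ?_)
  have hxr : 0 ≤ x * Real.cosh r := mul_nonneg hx (Real.cosh_pos r).le
  have hrw : lineFourier Φ r * exp (-(x : ℂ) * (Real.cosh r : ℂ)) - ∑ k ∈ Finset.range N,
      ((-x : ℂ) ^ k / k.factorial) * (lineFourier Φ r * (Real.cosh r : ℂ) ^ k) =
      lineFourier Φ r * (exp (-(x * Real.cosh r : ℝ)) -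
        ∑ k ∈ Finset.range N, (-(x * Real.cosh r : ℝ) : ℂ) ^ k / k.factorial) := by
    rw [mul_sub, Finset.mul_sum]
    congr 1
    · push_cast; ring_nf
    · refine Finset.sum_congr rfl fun k _ => ?_
      push_cast
      rw [← neg_mul, mul_pow]
      ring
  rw [hrw, norm_mul, norm_mul, norm_pow, norm_real, Real.norm_of_nonneg (Real.cosh_pos r).le]
  calc _ ≤ ‖lineFourier Φ r‖ * (K * (x * Real.cosh r) ^ N) := by
        gcongr
        exact hKb _ hxr
    _ = _ := by rw [mul_pow]; ring

theorem norm_coshLaplace_le_exp (hΦ : Integrable (lineFourier Φ)) {x : ℝ} (hx : 0 ≤ x) :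
    ‖coshLaplace Φ x‖ ≤ (∫ r : ℝ, ‖lineFourier Φ r‖) * Real.exp (-x) := by
  rw [coshLaplace, ← integral_mul_const]
  refine norm_integral_le_of_norm_le (hΦ.norm.mul_const _) (Eventually.of_forall fun r => ?_)
  rw [norm_mul, norm_exp_neg_mul_cosh]
  exact mul_le_mul_of_nonneg_left (exp_neg_mul_cosh_le hx r) (norm_nonneg _)

theorem continuousOn_coshLaplace (hΦ : Integrable (lineFourier Φ)) :
    ContinuousOn (coshLaplace Φ) (Ioi 0) := by
  refine continuousOn_of_dominated (bound := fun r => ‖lineFourier Φ r‖) (fun x _ => ?_)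
    (fun x hx => ?_) hΦ.norm (Eventually.of_forall fun r => by fun_prop)
  · exact hΦ.aestronglyMeasurable.mul (Continuous.aestronglyMeasurable (by fun_prop))
  · refine Eventually.of_forall fun r => ?_
    rw [norm_mul, norm_exp_neg_mul_cosh]
    refine mul_le_of_le_one_right (norm_nonneg _) ?_
    exact (exp_neg_mul_cosh_le (le_of_lt hx) r).trans
      (Real.exp_le_one_iff.2 (by linarith [mem_Ioi.1 hx]))

end CoshLaplace

theorem KBessel_eq_integral_exp {x : ℝ} (hx : 0 < x) (t : ℝ) : KBessel (t * I) x =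
    1 / 2 * ∫ r : ℝ, exp (-(x : ℂ) * (Real.cosh r : ℂ)) * exp (t * I * r) := by
  have hint : Integrable fun r : ℝ =>
      exp (-(x : ℂ) * (Real.cosh r : ℂ)) * exp (t * I * r) := by
    refine (integrable_exp_neg_mul_cosh hx).norm.mono'
      (Continuous.aestronglyMeasurable (by fun_prop)) (Eventually.of_forall fun r => ?_)
    rw [norm_mul]
    simp [norm_exp]
  have hsplit := integral_add_compl (measurableSet_Ioi (a := (0 : ℝ))) hint
  have hneg := integral_comp_neg_Iic (0 : ℝ)
    (fun r : ℝ => exp (-(x : ℂ) * (Real.cosh r : ℂ)) * exp (t * I * ((-r : ℝ) : ℂ)))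
  simp only [neg_neg, Real.cosh_neg, neg_zero] at hneg
  rw [compl_Ioi, hneg, ← integral_add hint.integrableOn] at hsplit
  · rw [← hsplit, KBessel, ← integral_const_mul]
    congr 1 with r
    rw [Complex.cosh]
    push_cast
    rw [mul_neg]
    ring
  · have := hint.comp_neg.integrableOn (s := Ioi 0)
    simp only [Real.cosh_neg] at this
    exact this

theorem Hflat_eq_coshLaplace {η : ℝ} (hη : 0 < η) {H : ℂ → ℂ} (hH : MemCeta η H) {y : ℝ}
    (hy : 0 < y) : Hflat H y = (1 / (4 * Real.pi)) * (Real.sqrt y *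
      coshLaplace (spectralDensity H) (2 * Real.pi * y)) := by
  obtain ⟨C, -, hC⟩ := exists_norm_spectralDensity_le hH
  have hΦ := integrable_imaginary_axis (by positivity) (differentiableOn_spectralDensity hH) hC
  have hx : 0 < 2 * Real.pi * y := by positivity
  have hE := integrable_exp_neg_mul_cosh hx
  rw [Hflat]
  congr 1
  have hpt : ∀ t : ℝ, H (t * I) * W2 (t * I) y / (Gamma (t * I) * Gamma (-(t * I))) =
      Real.sqrt y * ∫ r : ℝ, spectralDensity H (t * I) *
        (exp (-((2 * Real.pi * y : ℝ) : ℂ) * (Real.cosh r : ℂ)) * exp (t * I * r)) := by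
    intro t
    rw [mul_div_right_comm, div_Gamma_mul_Gamma_neg, W2, KBessel_eq_integral_exp hx,
      integral_const_mul]
    ring
  simp_rw [hpt]
  rw [integral_const_mul, integral_integral_swap, coshLaplace]
  · congr 2 with r
    rw [lineFourier, ← integral_mul_const]
    congr 1 with t
    ring
  · refine (hΦ.mul_prod hE).norm.mono' ?_ (Eventually.of_forall fun p => ?_)
    · exact hΦ.aestronglyMeasurable.comp_fst.mul (Continuous.aestronglyMeasurable (by fun_prop))
    · simp only [Function.uncurry, norm_mul]
      simp [norm_exp]

theorem mellinT_eq_mellin (h : ℝ → ℂ) (w : ℂ) : mellinT h w = mellin h w := by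
  simp only [mellinT, mellin, smul_eq_mul, mul_comm]

section HflatMellin

variable {η : ℝ} {H : ℂ → ℂ}

theorem locallyIntegrableOn_Hflat (hη : 0 < η) (hH : MemCeta η H) :
    LocallyIntegrableOn (Hflat H) (Ioi 0) := by
  obtain ⟨C, -, hC⟩ := exists_norm_spectralDensity_le hH
  have hG := integrable_lineFourier (by positivity) (differentiableOn_spectralDensity hH) hC
  refine ContinuousOn.locallyIntegrableOn ?_ measurableSet_Ioi
  refine ContinuousOn.congr ?_ fun y hy => Hflat_eq_coshLaplace hη hH hy
  refine continuousOn_const.mul (ContinuousOn.mul (by fun_prop) ?_)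
  refine (continuousOn_coshLaplace hG).comp (by fun_prop) fun y hy => ?_
  have : 0 < y := hy
  exact mem_Ioi.2 (by positivity)

theorem norm_Hflat (hη : 0 < η) (hH : MemCeta η H) {y : ℝ} (hy : 0 < y) : ‖Hflat H y‖ =
    1 / (4 * Real.pi) * (Real.sqrt y * ‖coshLaplace (spectralDensity H) (2 * Real.pi * y)‖) := by
  rw [Hflat_eq_coshLaplace hη hH hy, norm_mul, norm_mul, norm_real,
    Real.norm_of_nonneg (Real.sqrt_nonneg y)]
  congr 1
  simp [abs_of_pos Real.pi_pos]

theorem Hflat_isBigO_atTop (hη : 0 < η) (hH : MemCeta η H) :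
    Hflat H =O[atTop] fun t => Real.exp (-1 * t) := by
  obtain ⟨C, -, hC⟩ := exists_norm_spectralDensity_le hH
  have hG := integrable_lineFourier (by positivity) (differentiableOn_spectralDensity hH) hC
  set D := ∫ r : ℝ, ‖lineFourier (spectralDensity H) r‖
  have hD : 0 ≤ D := integral_nonneg fun _ => norm_nonneg _
  refine Asymptotics.IsBigO.of_bound (1 / (4 * Real.pi) * D) ?_
  filter_upwards [eventually_gt_atTop 0] with y hy
  rw [norm_Hflat hη hH hy, Real.norm_of_nonneg (Real.exp_pos _).le,
    mul_assoc (1 / (4 * Real.pi))]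
  refine mul_le_mul_of_nonneg_left ?_ (by positivity)
  have hsqrt : Real.sqrt y ≤ Real.exp y := by
    have h1 := Real.add_one_le_exp y
    exact Real.sqrt_le_iff.2 ⟨(Real.exp_pos y).le, by nlinarith⟩
  calc _ ≤ Real.exp y * (D * Real.exp (-(2 * Real.pi * y))) := by
        gcongr
        exact norm_coshLaplace_le_exp hG (by positivity)
    _ = D * Real.exp (y - 2 * Real.pi * y) := by rw [sub_eq_add_neg, Real.exp_add]; ring
    _ ≤ _ := by
        gcongr
        nlinarith [Real.two_le_pi]

theorem Hflat_isBigO_zero (hη : 1 < η) (hH : MemCeta η H) :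
    Hflat H =O[𝓝[>] 0] (· ^ (-(-η)) : ℝ → ℝ) := by
  obtain ⟨C, -, hC⟩ := exists_norm_spectralDensity_le hH
  have hη0 : 0 < η := by linarith
  have hN : (⌈η⌉₊ : ℝ) < 2 * η := (Nat.ceil_lt_add_one hη0.le).trans (by linarith)
  obtain ⟨D, hD, hDb⟩ := exists_norm_coshLaplace_le_pow (differentiableOn_spectralDensity hH) hC
    (spectralDensity_intCast H) hN
  refine Asymptotics.IsBigO.of_bound (1 / (4 * Real.pi) * (D * (2 * Real.pi) ^ ⌈η⌉₊)) ?_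
  filter_upwards [Ioo_mem_nhdsGT (zero_lt_one' ℝ)] with y hy
  have hy0 : 0 < y := hy.1
  rw [norm_Hflat hη0 hH hy0, neg_neg, Real.norm_of_nonneg (Real.rpow_nonneg hy0.le _),
    mul_assoc (1 / (4 * Real.pi))]
  refine mul_le_mul_of_nonneg_left ?_ (by positivity)
  calc _ ≤ 1 * (D * (2 * Real.pi * y) ^ ⌈η⌉₊) := by
        gcongr
        · exact Real.sqrt_le_one.2 hy.2.le
        · exact hDb _ (by positivity)
    _ = D * (2 * Real.pi) ^ ⌈η⌉₊ * y ^ (⌈η⌉₊ : ℝ) := by rw [Real.rpow_natCast]; ring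
    _ ≤ _ := mul_le_mul_of_nonneg_left
      (Real.rpow_le_rpow_of_exponent_ge hy0 hy.2.le (Nat.le_ceil η)) (by positivity)

theorem differentiableAt_mellinT_Hflat (hη : 1 < η) (hH : MemCeta η H) {w : ℂ} (hw : -η < w.re) :
    DifferentiableAt ℂ (mellinT (Hflat H)) w := by
  rw [funext (mellinT_eq_mellin (Hflat H))]
  have hη0 : 0 < η := by linarith
  exact mellin_differentiableAt_of_isBigO_rpow_exp one_pos (locallyIntegrableOn_Hflat hη0 hH)
    (Hflat_isBigO_atTop hη0 hH) (Hflat_isBigO_zero hη hH) hw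

theorem integrableOn_norm_Hflat_mul (hη : 1 < η) (hH : MemCeta η H) {σ : ℝ} (hσ : -η < σ) :
    IntegrableOn (fun y : ℝ => ‖Hflat H y‖ * y ^ (σ - 1)) (Ioi 0) := by
  have hη0 : 0 < η := by linarith
  have := mellinConvergent_of_isBigO_rpow_exp (s := (σ : ℂ)) one_pos
    (locallyIntegrableOn_Hflat hη0 hH) (Hflat_isBigO_atTop hη0 hH) (Hflat_isBigO_zero hη hH)
    (by simpa using hσ)
  refine IntegrableOn.congr_fun this.norm (fun y hy => ?_) measurableSet_Ioi
  rw [norm_smul, norm_cpow_eq_rpow_re_of_pos hy, mul_comm]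
  simp

theorem exists_norm_mellinT_Hflat_le (hη : 1 < η) (hH : MemCeta η H) {a b : ℝ} (ha : -η < a) :
    ∃ M, 0 ≤ M ∧ ∀ w : ℂ, a ≤ w.re → w.re ≤ b → ‖mellinT (Hflat H) w‖ ≤ M := by
  refine ⟨∫ y in Ioi (0 : ℝ), (‖Hflat H y‖ * y ^ (a - 1) + ‖Hflat H y‖ * y ^ (max a b - 1)),
    setIntegral_nonneg measurableSet_Ioi fun y hy => ?_, fun w h1 h2 => ?_⟩
  · have : 0 ≤ y := le_of_lt hy
    positivity
  · rw [mellinT]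
    refine norm_integral_le_of_norm_le ((integrableOn_norm_Hflat_mul hη hH ha).add
      (integrableOn_norm_Hflat_mul hη hH (ha.trans_le (le_max_left a b)))) ?_
    refine (ae_restrict_mem measurableSet_Ioi).mono fun y hy => ?_
    have hy0 : 0 < y := hy
    rw [norm_mul, norm_cpow_eq_rpow_re_of_pos hy, ← mul_add, sub_re, one_re]
    refine mul_le_mul_of_nonneg_left ?_ (norm_nonneg _)
    have p1 : 0 ≤ y ^ (a - 1) := Real.rpow_nonneg hy0.le _
    have p2 : 0 ≤ y ^ (max a b - 1) := Real.rpow_nonneg hy0.le _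
    rcases le_total y 1 with h | h
    · linarith [Real.rpow_le_rpow_of_exponent_ge hy0 h (show a - 1 ≤ w.re - 1 by linarith)]
    · linarith [Real.rpow_le_rpow_of_exponent_le h
        (show w.re - 1 ≤ max a b - 1 by linarith [le_max_right a b])]

theorem integral_lineFourier_mul_cosh_cpow {Φ : ℂ → ℂ} (hΦ : Integrable fun t : ℝ => Φ (t * I))
    {z : ℂ} (hz : 0 < z.re) : ∫ r : ℝ, lineFourier Φ r * (Real.cosh r : ℂ) ^ (-z) =
      2 ^ (z - 1) / Gamma z *
        ∫ t : ℝ, Φ (t * I) * (Gamma ((z + t * I) / 2) * Gamma ((z - t * I) / 2)) := by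
  have hc : Integrable fun r : ℝ => (Real.cosh r : ℂ) ^ (-z) :=
    integrable_of_norm_le_exp (continuous_cosh_cpow _) hz (norm_cosh_cpow_neg_le z hz.le)
  simp_rw [lineFourier, ← integral_mul_const]
  rw [integral_integral_swap, ← integral_const_mul]
  · congr 1 with t
    simp_rw [mul_assoc (Φ _)]
    rw [integral_const_mul, integral_exp_mul_cosh_cpow (by simpa using hz) (by simpa using hz)]
    ring
  · refine (hc.mul_prod hΦ).norm.mono' ?_ (Eventually.of_forall fun p => ?_)
    · refine AEStronglyMeasurable.mul (hΦ.aestronglyMeasurable.comp_snd.mul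
        (Continuous.aestronglyMeasurable (by fun_prop))) hc.aestronglyMeasurable.comp_fst
    · simp only [Function.uncurry, norm_mul]
      rw [mul_comm]
      simp [norm_exp]

theorem mellinT_Hflat_eq (hη : 0 < η) (hH : MemCeta η H) {z : ℂ} (hz : 0 < z.re) :
    mellinT (Hflat H) (z - 1 / 2) = (Real.pi : ℂ) ^ (-z) / (8 * Real.pi) * ∫ t : ℝ,
      spectralDensity H (t * I) * (Gamma ((z + t * I) / 2) * Gamma ((z - t * I) / 2)) := by
  obtain ⟨C, -, hC⟩ := exists_norm_spectralDensity_le hH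
  have hΦ := integrable_imaginary_axis (by positivity) (differentiableOn_spectralDensity hH) hC
  have hG := integrable_lineFourier (by positivity) (differentiableOn_spectralDensity hH) hC
  have hpi : (Real.pi : ℂ) ≠ 0 := by exact_mod_cast Real.pi_ne_zero
  have hΓ : Gamma z ≠ 0 := Gamma_ne_zero_of_re_pos hz
  have hstart : mellinT (Hflat H) (z - 1 / 2) = 1 / (4 * Real.pi) * ∫ y in Ioi (0 : ℝ), ∫ r : ℝ,
      lineFourier (spectralDensity H) r *
        ((y : ℂ) ^ (z - 1) * exp (-((2 * Real.pi * Real.cosh r : ℝ) * y : ℂ))) := by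
    rw [mellinT, ← integral_const_mul]
    refine setIntegral_congr_fun measurableSet_Ioi fun y hy => ?_
    have hy0 : (y : ℂ) ≠ 0 := by exact_mod_cast (ne_of_gt hy)
    have hpow : (y : ℂ) ^ (z - 1) = Real.sqrt y * (y : ℂ) ^ (z - 1 / 2 - 1) := by
      rw [Real.sqrt_eq_rpow, ofReal_cpow (le_of_lt hy), ← cpow_add _ _ hy0]
      congr 1
      push_cast
      ring
    rw [Hflat_eq_coshLaplace hη hH hy, mul_assoc, mul_right_comm, ← hpow, coshLaplace,
      ← integral_const_mul]
    congr 2 with r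
    rw [mul_left_comm]
    congr 3
    push_cast
    ring
  have hswap : ∀ r : ℝ, ∫ y in Ioi (0 : ℝ), lineFourier (spectralDensity H) r *
        ((y : ℂ) ^ (z - 1) * exp (-((2 * Real.pi * Real.cosh r : ℝ) * y : ℂ))) =
      (2 * Real.pi) ^ (-z) * Gamma z *
        (lineFourier (spectralDensity H) r * (Real.cosh r : ℂ) ^ (-z)) := by
    intro r
    have hc := Real.cosh_pos r
    rw [integral_const_mul, integral_cpow_mul_exp_neg_mul_Ioi hz (by positivity), one_div,
      inv_cpow _ _ ?_, ← cpow_neg, ofReal_mul, mul_cpow_ofReal_nonneg (by positivity) hc.le]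
    · push_cast
      ring
    · rw [arg_ofReal_of_nonneg (by positivity)]
      exact Real.pi_pos.ne
  rw [hstart, integral_integral_swap]
  · simp_rw [hswap]
    rw [integral_const_mul, integral_lineFourier_mul_cosh_cpow hΦ hz]
    have h2 : (2 * Real.pi : ℂ) ^ (-z) * 2 ^ (z - 1) = (Real.pi : ℂ) ^ (-z) / 2 := by
      have := mul_cpow_ofReal_nonneg zero_le_two Real.pi_pos.le (-z)
      push_cast at this
      rw [this, mul_right_comm, ← cpow_add _ _ two_ne_zero, neg_add_eq_sub, sub_right_comm,
        sub_self, zero_sub, cpow_neg_one]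
      ring
    generalize ∫ t : ℝ, spectralDensity H (t * I) * _ = J
    calc _ = 1 / (4 * Real.pi) * ((2 * Real.pi : ℂ) ^ (-z) * 2 ^ (z - 1)) *
          (Gamma z / Gamma z) * J := by ring
      _ = _ := by rw [h2, div_self hΓ]; ring
  · have hE := GammaIntegral_convergent hz
    refine (Integrable.mul_prod hE hG).norm.mono' ?_ ?_
    · refine AEStronglyMeasurable.mul hG.aestronglyMeasurable.comp_snd
        (AEStronglyMeasurable.mul ?_ (Continuous.aestronglyMeasurable (by fun_prop)))
      exact Measurable.aestronglyMeasurable (by fun_prop)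
    · filter_upwards [Measure.quasiMeasurePreserving_fst.ae
        (ae_restrict_mem (measurableSet_Ioi (a := (0 : ℝ))))] with p hp
      have hp0 : 0 < p.1 := hp
      simp only [Function.uncurry, norm_mul]
      rw [mul_comm, mul_comm ‖_ ^ _‖]
      gcongr
      rw [norm_real, norm_exp, Real.norm_of_nonneg (Real.exp_pos _).le]
      apply Real.exp_le_exp.2
      rw [← ofReal_mul, neg_re, ofReal_re]
      nlinarith [Real.one_le_cosh p.2, Real.two_le_pi, mul_pos hp0 Real.pi_pos]

end HflatMellin

theorem exists_norm_Gamma_le_of_abs_im_sub_le {a : ℝ} (ha : 0 < a) (b k : ℝ) : ∃ C, 0 < C ∧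
    ∀ (z : ℂ) (x : ℝ), a ≤ z.re → z.re ≤ b → |z.im - x| ≤ k →
      ‖Gamma z‖ ≤ C * Real.exp (-(7 / 5) * |x|) := by
  obtain ⟨C, hC, hb⟩ := exists_norm_Gamma_le (b := b) (Θ := 7 / 5) ha (by norm_num)
    (by linarith [Real.pi_gt_three])
  refine ⟨C * Real.exp (7 / 5 * k), by positivity, fun z x h1 h2 h3 => (hb z h1 h2).trans ?_⟩
  rw [mul_assoc, ← Real.exp_add]
  gcongr
  linarith [abs_sub_abs_le_abs_sub x z.im, abs_sub_comm x z.im]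

theorem exists_norm_Gamma_inv_le_of_abs_im_sub_le (a b k : ℝ) : ∃ C, 0 < C ∧
    ∀ (z : ℂ) (x : ℝ), a ≤ z.re → z.re ≤ b → |z.im - x| ≤ k →
      ‖(Gamma z)⁻¹‖ ≤ C * Real.exp (8 / 5 * |x|) := by
  obtain ⟨C, hC, hb⟩ := exists_norm_Gamma_inv_le a b
  refine ⟨C * Real.exp (8 / 5 * k), by positivity, fun z x h1 h2 h3 => (hb z h1 h2).trans ?_⟩
  rw [mul_assoc, ← Real.exp_add]
  gcongr
  linarith [abs_sub_abs_le_abs_sub z.im x]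

theorem differentiableAt_Gamma_of_re_pos {z : ℂ} (hz : 0 < z.re) : DifferentiableAt ℂ Gamma z := by
  refine differentiableAt_Gamma z fun m hm => ?_
  rw [hm, neg_re, natCast_re] at hz
  linarith [Nat.cast_nonneg (α := ℝ) m]

theorem continuous_Gamma_comp {X : Type*} [TopologicalSpace X] {f : X → ℂ} (hf : Continuous f)
    (hpos : ∀ x, 0 < (f x).re) : Continuous fun x => Gamma (f x) :=
  continuous_iff_continuousAt.2 fun x =>
    (differentiableAt_Gamma_of_re_pos (hpos x)).continuousAt.comp hf.continuousAt

/-- The part of the Mellin–Barnes integrand on `u = 1/100 + iv` not involving `H` or `μ`. -/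
noncomputable def barnesFactor (α : Fin 3 → ℂ) (s0 s s1 : ℂ) (v : ℝ) : ℂ :=
  (∏ i, Gamma ((s1 - α i) / 2)) * (Gamma ((1 + s1) / 2 - s0))⁻¹ *
    Gamma ((1 / 100 + v * I) / 2) * Gamma ((s1 - s0 + (1 / 100 + v * I)) / 2 + 1 / 2 - s) *
    (∏ i, Gamma ((s0 - (1 / 100 + v * I) + α i) / 2)) *
    Gamma (s - (s0 + (1 / 100 + v * I)) / 2) *
    (Gamma ((1 - (1 / 100 + v * I)) / 2))⁻¹ * (Gamma ((s0 - (1 / 100 + v * I) + s1) / 2))⁻¹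

theorem barnes_exponent_le (t v : ℝ) :
    Real.exp (-(7 / 5) * |t / 2|) ^ 3 * Real.exp (8 / 5 * |t / 2|) *
      Real.exp (-(7 / 5) * |v / 2|) * Real.exp (-(7 / 5) * |(t + v) / 2|) *
      Real.exp (-(7 / 5) * |-v / 2|) ^ 3 * Real.exp (-(7 / 5) * |-v / 2|) *
      Real.exp (8 / 5 * |-v / 2|) * Real.exp (8 / 5 * |(t - v) / 2|) ≤
    Real.exp (-1 * |t|) * Real.exp (-1 * |v|) := by
  simp only [← Real.exp_nat_mul, ← Real.exp_add, abs_div, abs_neg, abs_two]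
  apply Real.exp_le_exp.2
  have h1 : |t - v| ≤ |t + v| + 2 * |v| := by
    have := abs_sub (t + v) (2 * v)
    rw [abs_mul, abs_two] at this
    rwa [show t - v = t + v - 2 * v by ring]
  have h2 := abs_sub t v
  push_cast
  linarith [abs_nonneg t, abs_nonneg v]

section BarnesFactor

variable {α : Fin 3 → ℂ} {s0 s : ℂ} {a : ℝ}

theorem exists_norm_barnesFactor_le (hα : ∀ i, (α i).re = 0) (ha : 0 < a)
    (h0 : 1 / 100 < s0.re) (h1 : 0 < 2 * s.re - s0.re - 1 / 100)
    (h2 : s0.re + 2 * s.re - 1 - 1 / 100 < a) (b : ℝ) : ∃ C, 0 < C ∧ ∀ (s1 : ℂ) (v : ℝ),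
      a ≤ s1.re → s1.re ≤ b →
      ‖barnesFactor α s0 s s1 v‖ ≤ C * (Real.exp (-1 * |s1.im|) * Real.exp (-1 * |v|)) := by
  choose C1 hC1 hb1 using fun i => exists_norm_Gamma_le_of_abs_im_sub_le (a := a / 2)
    (by linarith) (b / 2) (|(α i).im| / 2)
  obtain ⟨C2, hC2, hb2⟩ := exists_norm_Gamma_inv_le_of_abs_im_sub_le
    ((1 + a) / 2 - s0.re) ((1 + b) / 2 - s0.re) |s0.im|
  obtain ⟨C3, hC3, hb3⟩ := exists_norm_Gamma_le_of_abs_im_sub_le (a := 1 / 200)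
    (by norm_num) (1 / 200) 0
  obtain ⟨C4, hC4, hb4⟩ := exists_norm_Gamma_le_of_abs_im_sub_le
    (a := (a - s0.re + 1 / 100) / 2 + 1 / 2 - s.re) (by linarith)
    ((b - s0.re + 1 / 100) / 2 + 1 / 2 - s.re) |s0.im / 2 + s.im|
  choose C5 hC5 hb5 using fun i => exists_norm_Gamma_le_of_abs_im_sub_le
    (a := (s0.re - 1 / 100) / 2) (by linarith) ((s0.re - 1 / 100) / 2) |(s0.im + (α i).im) / 2|
  obtain ⟨C6, hC6, hb6⟩ := exists_norm_Gamma_le_of_abs_im_sub_le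
    (a := s.re - (s0.re + 1 / 100) / 2) (by linarith) (s.re - (s0.re + 1 / 100) / 2)
    |s.im - s0.im / 2|
  obtain ⟨C7, hC7, hb7⟩ := exists_norm_Gamma_inv_le_of_abs_im_sub_le (99 / 200) (99 / 200) 0
  obtain ⟨C8, hC8, hb8⟩ := exists_norm_Gamma_inv_le_of_abs_im_sub_le
    ((s0.re - 1 / 100 + a) / 2) ((s0.re - 1 / 100 + b) / 2) |s0.im / 2|
  have hK : 0 < (∏ i, C1 i) * C2 * C3 * C4 * (∏ i, C5 i) * C6 * C7 * C8 := by
    have := Finset.prod_pos fun i (_ : i ∈ Finset.univ) => hC1 i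
    have := Finset.prod_pos fun i (_ : i ∈ Finset.univ) => hC5 i
    positivity
  refine ⟨_, hK, fun s1 v hl hr => ?_⟩
  have e1 : ‖∏ i, Gamma ((s1 - α i) / 2)‖ ≤
      (∏ i, C1 i) * Real.exp (-(7 / 5) * |s1.im / 2|) ^ 3 := by
    rw [norm_prod]
    refine (Finset.prod_le_prod (fun i _ => norm_nonneg _) fun i _ =>
      hb1 i ((s1 - α i) / 2) (s1.im / 2) ?_ ?_ ?_).trans_eq (by simp [Finset.prod_mul_distrib])
    · simp [hα i]; linarith
    · simp [hα i]; linarith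
    · simp only [div_ofNat_im, sub_im]
      rw [← sub_div, sub_sub_cancel_left, abs_div, abs_neg, abs_two]
  have e2 := hb2 ((1 + s1) / 2 - s0) (s1.im / 2) (by simp; linarith) (by simp; linarith) (by simp)
  have e3 := hb3 ((1 / 100 + v * I) / 2) (v / 2) (by norm_num) (by norm_num) (by norm_num)
  have e4 := hb4 ((s1 - s0 + (1 / 100 + v * I)) / 2 + 1 / 2 - s) ((s1.im + v) / 2)
    (by norm_num; linarith) (by norm_num; linarith) (by
      rw [← abs_neg]
      norm_num
      ring_nf
      rfl)
  have e5 : ‖∏ i, Gamma ((s0 - (1 / 100 + v * I) + α i) / 2)‖ ≤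
      (∏ i, C5 i) * Real.exp (-(7 / 5) * |-v / 2|) ^ 3 := by
    rw [norm_prod]
    refine (Finset.prod_le_prod (fun i _ => norm_nonneg _) fun i _ =>
      hb5 i ((s0 - (1 / 100 + v * I) + α i) / 2) (-v / 2) ?_ ?_ ?_).trans_eq
        (by simp [Finset.prod_mul_distrib])
    · norm_num [hα i]
    · norm_num [hα i]
    · norm_num
      ring_nf
      rfl
  have e6 := hb6 (s - (s0 + (1 / 100 + v * I)) / 2) (-v / 2) (by norm_num) (by norm_num) (by
      norm_num
      ring_nf
      rfl)
  have e7 := hb7 ((1 - (1 / 100 + v * I)) / 2) (-v / 2) (by norm_num) (by norm_num) (by norm_num)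
  have e8 := hb8 ((s0 - (1 / 100 + v * I) + s1) / 2) ((s1.im - v) / 2)
    (by norm_num; linarith) (by norm_num; linarith) (by
      norm_num
      ring_nf
      rfl)
  have hp1 := (norm_nonneg _).trans e1
  have hp5 := (norm_nonneg _).trans e5
  rw [barnesFactor]
  simp only [norm_mul]
  refine le_trans ?_ (mul_le_mul_of_nonneg_left (barnes_exponent_le s1.im v) hK.le)
  calc _ ≤ (∏ i, C1 i) * Real.exp (-(7 / 5) * |s1.im / 2|) ^ 3 *
        (C2 * Real.exp (8 / 5 * |s1.im / 2|)) * (C3 * Real.exp (-(7 / 5) * |v / 2|)) *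
        (C4 * Real.exp (-(7 / 5) * |(s1.im + v) / 2|)) *
        ((∏ i, C5 i) * Real.exp (-(7 / 5) * |-v / 2|) ^ 3) *
        (C6 * Real.exp (-(7 / 5) * |-v / 2|)) * (C7 * Real.exp (8 / 5 * |-v / 2|)) *
        (C8 * Real.exp (8 / 5 * |(s1.im - v) / 2|)) := by gcongr
    _ = _ := by ring

theorem continuous_barnesFactor_line (hα : ∀ i, (α i).re = 0) (ha : 0 < a)
    (h0 : 1 / 100 < s0.re) (h1 : 0 < 2 * s.re - s0.re - 1 / 100)
    (h2 : s0.re + 2 * s.re - 1 - 1 / 100 < a) :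
    Continuous fun p : ℝ × ℝ => barnesFactor α s0 s (a + p.1 * I) p.2 := by
  unfold barnesFactor
  refine ((((((Continuous.mul ?_ ?_).mul ?_).mul ?_).mul ?_).mul ?_).mul ?_).mul ?_
  · refine continuous_finsetProd _ fun i _ => continuous_Gamma_comp (by fun_prop) fun p => ?_
    norm_num [hα i]; linarith
  · exact continuous_Gamma_inv.comp (by fun_prop)
  · exact continuous_Gamma_comp (by fun_prop) fun p => by norm_num
  · exact continuous_Gamma_comp (by fun_prop) fun p => by norm_num; linarith
  · refine continuous_finsetProd _ fun i _ => continuous_Gamma_comp (by fun_prop) fun p => ?_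
    norm_num [hα i]; linarith
  · exact continuous_Gamma_comp (by fun_prop) fun p => by norm_num; linarith
  · exact continuous_Gamma_inv.comp (by fun_prop)
  · exact continuous_Gamma_inv.comp (by fun_prop)

theorem differentiableAt_barnesFactor (hα : ∀ i, (α i).re = 0) (v : ℝ) {s1 : ℂ} (ha : 0 < s1.re)
    (h2 : s0.re + 2 * s.re - 1 - 1 / 100 < s1.re) :
    DifferentiableAt ℂ (fun s1 => barnesFactor α s0 s s1 v) s1 := by
  unfold barnesFactor
  refine DifferentiableAt.mul (((((((DifferentiableAt.mul ?_ ?_).mul_const _).mul ?_).mul_const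
    _).mul_const _).mul_const _)) ?_
  · refine DifferentiableAt.fun_finsetProd fun i _ =>
      (differentiableAt_Gamma_of_re_pos ?_).comp s1 (by fun_prop)
    norm_num [hα i]; linarith
  · exact (differentiable_one_div_Gamma _).comp s1 (by fun_prop)
  · refine (differentiableAt_Gamma_of_re_pos ?_).comp s1 (by fun_prop)
    norm_num; linarith
  · exact (differentiable_one_div_Gamma _).comp s1 (by fun_prop)

end BarnesFactor

theorem integrable_exp_mul_exp :
    Integrable fun p : ℝ × ℝ => Real.exp (-1 * |p.1|) * Real.exp (-1 * |p.2|) :=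
  (integrable_exp_neg_mul_abs one_pos).mul_prod (integrable_exp_neg_mul_abs one_pos)

section Assembly

variable {η : ℝ} {H : ℂ → ℂ} {α : Fin 3 → ℂ} {s0 s : ℂ} {a : ℝ}

theorem differentiableAt_mellinT_Hflat_mul_barnesFactor (hη : 1 < η) (hH : MemCeta η H)
    (hα : ∀ i, (α i).re = 0) (v : ℝ) {s1 : ℂ} (ha : 0 < s1.re)
    (h2 : s0.re + 2 * s.re - 1 - 1 / 100 < s1.re) (h3 : s1.re < s.re + η - 1 / 2) :
    DifferentiableAt ℂ (fun s1 => mellinT (Hflat H) (s - s1 - 1 / 2) * (Real.pi : ℂ) ^ (-s1) *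
      barnesFactor α s0 s s1 v) s1 := by
  have hpi : (Real.pi : ℂ) ≠ 0 := by exact_mod_cast Real.pi_ne_zero
  refine (DifferentiableAt.mul ?_ ?_).mul (differentiableAt_barnesFactor hα v ha h2)
  · refine DifferentiableAt.comp (g := mellinT (Hflat H)) s1
      (differentiableAt_mellinT_Hflat hη hH ?_) (by fun_prop)
    norm_num
    linarith
  · exact (differentiableAt_id.neg).const_cpow (Or.inl hpi)

theorem exists_norm_mellinT_Hflat_mul_barnesFactor_le (hη : 1 < η) (hH : MemCeta η H)
    (hα : ∀ i, (α i).re = 0) (ha : 0 < a) (h0 : 1 / 100 < s0.re)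
    (h1 : 0 < 2 * s.re - s0.re - 1 / 100) (h2 : s0.re + 2 * s.re - 1 - 1 / 100 < a) :
    ∃ C, ∀ (s1 : ℂ) (v : ℝ), a ≤ s1.re → s1.re ≤ η - 1 / 2 →
      ‖mellinT (Hflat H) (s - s1 - 1 / 2) * (Real.pi : ℂ) ^ (-s1) * barnesFactor α s0 s s1 v‖ ≤
        C * (Real.exp (-1 * |s1.im|) * Real.exp (-1 * |v|)) := by
  obtain ⟨C, hC, hCb⟩ := exists_norm_barnesFactor_le hα ha h0 h1 h2 (η - 1 / 2)
  obtain ⟨M, hM, hMb⟩ := exists_norm_mellinT_Hflat_le hη hH (a := s.re - η) (b := s.re) (by linarith)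
  refine ⟨M * C, fun s1 v hl hr => ?_⟩
  have e1 : ‖mellinT (Hflat H) (s - s1 - 1 / 2)‖ ≤ M :=
    hMb _ (by norm_num; linarith) (by norm_num; linarith)
  have e2 : ‖(Real.pi : ℂ) ^ (-s1)‖ ≤ 1 := by
    rw [norm_cpow_eq_rpow_re_of_pos Real.pi_pos]
    exact Real.rpow_le_one_of_one_le_of_nonpos (by linarith [Real.pi_gt_three])
      (by rw [neg_re]; linarith)
  rw [norm_mul, norm_mul, mul_assoc M]
  refine mul_le_mul ?_ (hCb s1 v hl hr) (norm_nonneg _) hM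
  simpa using mul_le_mul e1 e2 (norm_nonneg _) hM

theorem integrable_mellinT_Hflat_mul_barnesFactor (hη : 1 < η) (hH : MemCeta η H)
    (hα : ∀ i, (α i).re = 0) (ha : 0 < a) (h0 : 1 / 100 < s0.re)
    (h1 : 0 < 2 * s.re - s0.re - 1 / 100) (h2 : s0.re + 2 * s.re - 1 - 1 / 100 < a)
    (h3 : a ≤ η - 1 / 2) :
    Integrable fun p : ℝ × ℝ => mellinT (Hflat H) (s - (a + p.1 * I) - 1 / 2) *
      (Real.pi : ℂ) ^ (-(a + p.1 * I)) * barnesFactor α s0 s (a + p.1 * I) p.2 := by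
  obtain ⟨C, hC⟩ := exists_norm_mellinT_Hflat_mul_barnesFactor_le hη hH hα ha h0 h1 h2
  have hpi : (Real.pi : ℂ) ≠ 0 := by exact_mod_cast Real.pi_ne_zero
  refine (integrable_exp_mul_exp.const_mul C).mono' (Continuous.aestronglyMeasurable ?_)
    (Eventually.of_forall fun p => ?_)
  · refine (Continuous.mul ?_ ?_).mul (continuous_barnesFactor_line hα ha h0 h1 h2)
    · refine continuous_iff_continuousAt.2 fun p => ContinuousAt.comp (g := mellinT (Hflat H))
        (differentiableAt_mellinT_Hflat hη hH ?_).continuousAt (by fun_prop)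
      norm_num
      linarith
    · exact Continuous.const_cpow (by fun_prop) (Or.inl hpi)
  · simpa using hC (a + p.1 * I) p.2 (by simp) (by simpa using h3)

/-- Moving the `s₁`-line of the double integral defining the transform. -/
theorem integral_mellinT_Hflat_mul_barnesFactor_eq (hη : 1 < η) (hH : MemCeta η H)
    (hα : ∀ i, (α i).re = 0) (ha : 0 < a) (h0 : 1 / 100 < s0.re)
    (h1 : 0 < 2 * s.re - s0.re - 1 / 100) (h2 : s0.re + 2 * s.re - 1 - 1 / 100 < a)
    (h3 : a ≤ η - 1 / 2) :
    ∫ t1 : ℝ, ∫ v : ℝ, mellinT (Hflat H) (s - ((η - 1 / 2 : ℝ) + t1 * I) - 1 / 2) *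
      (Real.pi : ℂ) ^ (-((η - 1 / 2 : ℝ) + t1 * I)) *
        barnesFactor α s0 s ((η - 1 / 2 : ℝ) + t1 * I) v =
    ∫ t1 : ℝ, ∫ v : ℝ, mellinT (Hflat H) (s - (a + t1 * I) - 1 / 2) *
      (Real.pi : ℂ) ^ (-(a + t1 * I)) * barnesFactor α s0 s (a + t1 * I) v := by
  refine (integral_integral_swap (integrable_mellinT_Hflat_mul_barnesFactor hη hH hα
      (ha.trans_le h3) h0 h1 (h2.trans_le h3) le_rfl)).trans (Eq.trans ?_ (integral_integral_swap
        (integrable_mellinT_Hflat_mul_barnesFactor hη hH hα ha h0 h1 h2 h3)).symm)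
  congr 1 with v
  obtain ⟨C, hC⟩ := exists_norm_mellinT_Hflat_mul_barnesFactor_le hη hH hα ha h0 h1 h2
  refine (integral_vertical_line_eq (f := fun s1 => mellinT (Hflat H) (s - s1 - 1 / 2) *
    (Real.pi : ℂ) ^ (-s1) * barnesFactor α s0 s s1 v) (C := C * Real.exp (-1 * |v|)) h3
    (fun z hz => ?_) one_pos fun z hl hr => ?_).symm
  · exact (differentiableAt_mellinT_Hflat_mul_barnesFactor hη hH hα v (ha.trans_le hz.1)
      (h2.trans_le hz.1) (by linarith [hz.2])).differentiableWithinAt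
  · exact (hC z v hl hr).trans_eq (by ring)

theorem exists_norm_Gamma_mul_Gamma_le (has : a < s.re) : ∃ G, 0 < G ∧ ∀ t t1 : ℝ,
    ‖Gamma ((s - (a + t1 * I) + t * I) / 2) * Gamma ((s - (a + t1 * I) - t * I) / 2)‖ ≤ G := by
  obtain ⟨G, hG, hb⟩ := exists_norm_Gamma_le (a := (s.re - a) / 2) (b := (s.re - a) / 2)
    (Θ := 0) (by linarith) le_rfl (by positivity)
  refine ⟨G * G, by positivity, fun t t1 => ?_⟩
  rw [norm_mul]
  have hz : ∀ z : ℂ, z.re = (s.re - a) / 2 → ‖Gamma z‖ ≤ G := fun z hz => by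
    simpa using hb z hz.ge hz.le
  exact mul_le_mul (hz _ (by simp)) (hz _ (by simp)) (norm_nonneg _) hG.le

/-- Exchanging the spectral integral with the two Mellin–Barnes integrals. -/
theorem integral_spectralDensity_swap (hη : 0 < η) (hH : MemCeta η H)
    (hα : ∀ i, (α i).re = 0) (ha : 0 < a) (h0 : 1 / 100 < s0.re)
    (h1 : 0 < 2 * s.re - s0.re - 1 / 100) (h2 : s0.re + 2 * s.re - 1 - 1 / 100 < a)
    (has : a < s.re) :
    ∫ t1 : ℝ, ∫ v : ℝ, ∫ t : ℝ, spectralDensity H (t * I) *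
      (Gamma ((s - (a + t1 * I) + t * I) / 2) * Gamma ((s - (a + t1 * I) - t * I) / 2) *
        barnesFactor α s0 s (a + t1 * I) v) =
    ∫ t : ℝ, spectralDensity H (t * I) * ∫ t1 : ℝ, ∫ v : ℝ,
      Gamma ((s - (a + t1 * I) + t * I) / 2) * Gamma ((s - (a + t1 * I) - t * I) / 2) *
        barnesFactor α s0 s (a + t1 * I) v := by
  obtain ⟨C, -, hC⟩ := exists_norm_spectralDensity_le hH
  have hΦ := integrable_imaginary_axis (by positivity) (differentiableOn_spectralDensity hH) hC
  obtain ⟨D, hD, hDb⟩ := exists_norm_barnesFactor_le hα ha h0 h1 h2 a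
  obtain ⟨G, hG, hGb⟩ := exists_norm_Gamma_mul_Gamma_le has
  have hcont : Continuous fun q : ℝ × (ℝ × ℝ) =>
      Gamma ((s - (a + q.2.1 * I) + q.1 * I) / 2) * Gamma ((s - (a + q.2.1 * I) - q.1 * I) / 2) *
        barnesFactor α s0 s (a + q.2.1 * I) q.2.2 := by
    refine (Continuous.mul ?_ ?_).mul
      ((continuous_barnesFactor_line hα ha h0 h1 h2).comp continuous_snd)
    · exact continuous_Gamma_comp (by fun_prop) fun q => by simpa using has
    · exact continuous_Gamma_comp (by fun_prop) fun q => by simpa using has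
  have hbound : ∀ q : ℝ × (ℝ × ℝ),
      ‖Gamma ((s - (a + q.2.1 * I) + q.1 * I) / 2) * Gamma ((s - (a + q.2.1 * I) - q.1 * I) / 2) *
        barnesFactor α s0 s (a + q.2.1 * I) q.2.2‖ ≤
      G * D * (Real.exp (-1 * |q.2.1|) * Real.exp (-1 * |q.2.2|)) := fun q => by
    rw [norm_mul, mul_assoc]
    refine mul_le_mul (hGb q.1 q.2.1) ?_ (norm_nonneg _) hG.le
    simpa using hDb (a + q.2.1 * I) q.2.2 (by simp) (by simp)
  have hsec : ∀ t : ℝ, Integrable fun p : ℝ × ℝ =>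
      Gamma ((s - (a + p.1 * I) + t * I) / 2) * Gamma ((s - (a + p.1 * I) - t * I) / 2) *
        barnesFactor α s0 s (a + p.1 * I) p.2 := fun t =>
    (integrable_exp_mul_exp.const_mul (G * D)).mono'
      (hcont.comp (Continuous.prodMk_right t)).aestronglyMeasurable
      (Eventually.of_forall fun p => hbound (t, p))
  have htriple : Integrable fun q : ℝ × (ℝ × ℝ) => spectralDensity H (q.1 * I) *
      (Gamma ((s - (a + q.2.1 * I) + q.1 * I) / 2) *
        Gamma ((s - (a + q.2.1 * I) - q.1 * I) / 2) *
        barnesFactor α s0 s (a + q.2.1 * I) q.2.2) := by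
    refine (hΦ.norm.mul_prod (integrable_exp_mul_exp.const_mul (G * D))).mono'
      (hΦ.aestronglyMeasurable.comp_fst.mul hcont.aestronglyMeasurable)
      (Eventually.of_forall fun q => ?_)
    rw [norm_mul]
    exact mul_le_mul_of_nonneg_left (hbound q) (norm_nonneg _)
  calc _ = ∫ p : ℝ × ℝ, ∫ t : ℝ, spectralDensity H (t * I) *
        (Gamma ((s - (a + p.1 * I) + t * I) / 2) * Gamma ((s - (a + p.1 * I) - t * I) / 2) *
          barnesFactor α s0 s (a + p.1 * I) p.2) :=
        (integral_prod _ htriple.integral_prod_right).symm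
    _ = _ := by
      rw [← integral_integral_swap htriple]
      congr 1 with t
      rw [integral_const_mul]
      exact congrArg _ (integral_prod _ (hsec t))

end Assembly

/-- Kernel form of the archimedean transform (Proposition 9.5 of the paper):
`(F_α H)(s₀,s)` is an integral of the kernel `K_{σ₁}` against the spectral measure,
for any admissible abscissa `σ₁`. -/
theorem kernel_form_of_transform (η : ℝ) (hη : 40 < η)
    (H : ℂ → ℂ) (hH : MemCeta η H)
    (α : Fin 3 → ℂ) (hre : ∀ i, (α i).re = 0) (hsum : α 0 + α 1 + α 2 = 0)
    (s0 s : ℂ)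
    (h₁ : 1/100 < s0.re) (h₂ : s.re < 4) (h₃ : 0 < 2 * s.re - s0.re - 1/100)
    (h₄ : 0 < s0.re + 2 * s.re - 1 - 1/100) (h₅ : 0 < 1 + 1/100 - s0.re - s.re)
    (σ1 : ℝ) (hσa : s0.re + 2 * s.re - 1 - 1/100 < σ1) (hσb : σ1 < s.re) :
    FtransMain η α H s0 s =
      ((Real.pi : ℂ) ^ (1/2 - s) / 4) * ((1 / (2 * (Real.pi : ℂ))) *
        ∫ t : ℝ, (H (t * I) / (Complex.Gamma (t * I) * Complex.Gamma (-(t * I)))) *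
          Kker σ1 s0 s α (t * I)) := by
  have hη0 : 0 < η := by linarith
  have ha : 0 < σ1 := h₄.trans hσa
  have hpi : (Real.pi : ℂ) ≠ 0 := by exact_mod_cast Real.pi_ne_zero
  have hF : FtransMain η α H s0 s = (Real.sqrt Real.pi : ℂ) * (1 / (2 * (Real.pi : ℂ))) ^ 2 *
      ∫ t1 : ℝ, ∫ v : ℝ, mellinT (Hflat H) (s - ((η - 1 / 2 : ℝ) + t1 * I) - 1 / 2) *
        (Real.pi : ℂ) ^ (-((η - 1 / 2 : ℝ) + t1 * I)) *
          barnesFactor α s0 s ((η - 1 / 2 : ℝ) + t1 * I) v := by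
    rw [FtransMain]
    congr 3 with t1
    congr 1 with v
    simp only [barnesFactor]
    rw [div_eq_mul_inv, div_eq_mul_inv, mul_inv]
    ring
  have hK : ∀ t : ℝ, Kker σ1 s0 s α (t * I) = (1 / (2 * (Real.pi : ℂ))) ^ 2 *
      ∫ t1 : ℝ, ∫ v : ℝ,
        Gamma ((s - (σ1 + t1 * I) + t * I) / 2) * Gamma ((s - (σ1 + t1 * I) - t * I) / 2) *
          barnesFactor α s0 s (σ1 + t1 * I) v := fun t => by
    rw [Kker]
    congr 3 with t1
    congr 1 with v
    simp only [barnesFactor]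
    rw [div_eq_mul_inv, div_eq_mul_inv, mul_inv]
    ring
  have hpt : ∀ t1 v : ℝ, mellinT (Hflat H) (s - (σ1 + t1 * I) - 1 / 2) *
      (Real.pi : ℂ) ^ (-(σ1 + t1 * I)) * barnesFactor α s0 s (σ1 + t1 * I) v =
      (Real.pi : ℂ) ^ (-s) / (8 * Real.pi) * ∫ t : ℝ, spectralDensity H (t * I) *
        (Gamma ((s - (σ1 + t1 * I) + t * I) / 2) * Gamma ((s - (σ1 + t1 * I) - t * I) / 2) *
          barnesFactor α s0 s (σ1 + t1 * I) v) := fun t1 v => by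
    have hpow : (Real.pi : ℂ) ^ (-s) =
        (Real.pi : ℂ) ^ (-(s - (σ1 + t1 * I))) * (Real.pi : ℂ) ^ (-(σ1 + t1 * I)) := by
      rw [← cpow_add _ _ hpi]
      ring_nf
    rw [mellinT_Hflat_eq hη0 hH (by simpa using hσb), hpow]
    simp_rw [← mul_assoc]
    rw [integral_mul_const]
    ring
  have hsqrt : (Real.pi : ℂ) ^ (1 / 2 - s) = Real.sqrt Real.pi * (Real.pi : ℂ) ^ (-s) := by
    rw [Real.sqrt_eq_rpow, ofReal_cpow Real.pi_pos.le, ← cpow_add _ _ hpi]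
    push_cast
    ring_nf
  rw [hF, integral_mellinT_Hflat_mul_barnesFactor_eq (by linarith) hH hre ha h₁ h₃ hσa
    (by linarith)]
  simp_rw [hpt, integral_const_mul]
  rw [integral_spectralDensity_swap hη0 hH hre ha h₁ h₃ hσa hσb, hsqrt]
  simp_rw [hK, div_Gamma_mul_Gamma_neg, mul_left_comm (spectralDensity H _)]
  rw [integral_const_mul]
  ring
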